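/- arXiv:1611.09909 — 3 statements merged into one kernel-verified Lean document; each statement's English description precedes it below -/
import Mathlib

section
/- Fix Δ < 1 (equivalently c > 0 with Δ = (2−c²)/2) and n ≤ N/2. Assume p₁,…,pₙ ∈ D_Δ are distinct and satisfy the Bethe equations exp(iNp_j) = (−1)^{n−1} exp(−i Σ_{k=1}^n Θ(p_j,p_k)) for every j, and let ψ be the Bethe ansatz vector. Then H ψ = E ψ, where H is the XXZ Hamiltonian and E = NΔ/2 − 2 Σ_{k=1}^n [Δ − cos(p_k)]. -/
open scoped BigOperators
open Complex

noncomputable section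

/-- `S(x,y) = e^{-ix} + e^{iy} - 2*Delta`. -/
def Sfun (Δ x y : ℝ) : ℂ :=
  Complex.exp (-(Complex.I * (x : ℂ))) + Complex.exp (Complex.I * (y : ℂ)) - 2 * (Δ : ℂ)

/-- `μ`, the unique solution of `cos μ = -Δ` in `[0, π)` when `Δ ∈ [-1, 1)`, and `0` when `Δ < -1`. -/
def muD (Δ : ℝ) : ℝ := if -1 ≤ Δ then Real.arccos (-Δ) else 0

/-- `D_Δ = (-π + μ, π - μ)`. -/
def Ddom (Δ : ℝ) : Set ℝ := Set.Ioo (-Real.pi + muD Δ) (Real.pi - muD Δ)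

/-- `L(z) = 1 + c²z/(1-z)`. -/
def Lfun (c : ℝ) (z : ℂ) : ℂ := 1 + (c : ℂ) ^ 2 * z / (1 - z)

/-- `M(z) = 1 - c²/(1-z)`. -/
def Mfun (c : ℝ) (z : ℂ) : ℂ := 1 - (c : ℂ) ^ 2 / (1 - z)

/-- `z_j = e^{i p_j}`. -/
def zOf {n : ℕ} (p : Fin n → ℝ) : Fin n → ℂ := fun j => Complex.exp (Complex.I * (p j : ℂ))

/-- The coefficient `A_σ`. -/
def Acoef {n : ℕ} (Δ : ℝ) (p : Fin n → ℝ) (σ : Equiv.Perm (Fin n)) : ℂ :=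
  ((Equiv.Perm.sign σ : ℤ) : ℂ) *
    ∏ kl ∈ Finset.univ.filter (fun kl : Fin n × Fin n => kl.1 < kl.2),
      Complex.exp (Complex.I * (p (σ kl.1) : ℂ)) * Sfun Δ (p (σ kl.1)) (p (σ kl.2))

/-- The Bethe ansatz vector `ψ`. -/
def psiVec (N n : ℕ) (Δ : ℝ) (p : Fin n → ℝ) : Finset (Fin N) → ℂ := fun A =>
  if h : A.card = n then
    ∑ σ : Equiv.Perm (Fin n), Acoef Δ p σ *
      ∏ k : Fin n, Complex.exp (Complex.I * (p (σ k) : ℂ) *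
        ((((A.orderIsoOfFin h k : Fin N) : ℕ) + 1 : ℕ) : ℂ))
  else 0

open scoped Classical in
/-- The summand `H_i` of the XXZ Hamiltonian. -/
def HXi (N : ℕ) [NeZero N] (Δ : ℝ) (i : Fin N) :
    Matrix (Finset (Fin N)) (Finset (Fin N)) ℂ :=
  Matrix.of fun A B =>
    if A = B then (if ((i ∈ A) ↔ ((i + 1) ∈ A)) then (Δ : ℂ) / 2 else -((Δ : ℂ) / 2))
    else if (¬ ((i ∈ A) ↔ ((i + 1) ∈ A))) ∧ B = A.image (Equiv.swap i (i + 1)) then 1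
    else 0

/-- The XXZ Hamiltonian `H = ∑_i H_i`. -/
def HX (N : ℕ) [NeZero N] (Δ : ℝ) : Matrix (Finset (Fin N)) (Finset (Fin N)) ℂ :=
  ∑ i : Fin N, HXi N Δ i


def bS {n : ℕ} (d : ℂ) (z : Fin n → ℂ) (i j : Fin n) : ℂ := 1 + z i * z j - 2 * d * z i

def bG {n : ℕ} (d : ℂ) (z : Fin n → ℂ) (σ : Equiv.Perm (Fin n)) : ℂ :=
  ∏ kl ∈ Finset.univ.filter (fun kl : Fin n × Fin n => kl.1 < kl.2), bS d z (σ kl.1) (σ kl.2)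

def bF {n : ℕ} (d : ℂ) (z : Fin n → ℂ) (x : Fin n → ℤ) : ℂ :=
  ∑ σ : Equiv.Perm (Fin n), ((Equiv.Perm.sign σ : ℤ) : ℂ) * bG d z σ * ∏ k, z (σ k) ^ (x k)

lemma prod_add_single {n : ℕ} (w : Fin n → ℂ) (hw : ∀ i, w i ≠ 0) (x : Fin n → ℤ) (k : Fin n)
    (e : ℤ) : ∏ j, w j ^ ((x + Pi.single k e : Fin n → ℤ) j) = (∏ j, w j ^ (x j)) * w k ^ e := by
  have : ∀ j, w j ^ ((x + Pi.single k e : Fin n → ℤ) j) = w j ^ (x j) * (if j = k then w k ^ e else 1) := by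
    intro j
    by_cases h : j = k
    · subst h
      simp [zpow_add₀ (hw j)]
    · simp [h]
  simp only [this, Finset.prod_mul_distrib]
  simp

lemma bF_add {n : ℕ} (d : ℂ) (z : Fin n → ℂ) (hz : ∀ i, z i ≠ 0) (x : Fin n → ℤ) (k : Fin n)
    (e : ℤ) : bF d z (x + Pi.single k e) =
      ∑ σ : Equiv.Perm (Fin n), ((Equiv.Perm.sign σ : ℤ) : ℂ) * bG d z σ *
        (∏ k, z (σ k) ^ (x k)) * z (σ k) ^ e := by
  unfold bF
  refine Finset.sum_congr rfl fun σ _ => ?_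
  rw [prod_add_single (fun j => z (σ j)) (fun j => hz _)]
  ring

lemma bF_laplace {n : ℕ} (d : ℂ) (z : Fin n → ℂ) (hz : ∀ i, z i ≠ 0) (x : Fin n → ℤ) :
    ∑ k, (bF d z (x + Pi.single k 1) + bF d z (x + Pi.single k (-1))) =
      (∑ k, (z k + (z k)⁻¹)) * bF d z x := by
  simp only [bF_add d z hz, ← Finset.sum_add_distrib]
  rw [Finset.sum_comm]
  unfold bF
  rw [Finset.mul_sum]
  refine Finset.sum_congr rfl fun σ _ => ?_
  rw [← Equiv.sum_comp σ (fun k => z k + (z k)⁻¹), Finset.sum_mul]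
  refine Finset.sum_congr rfl fun k _ => ?_
  simp only [zpow_one, zpow_neg]
  ring

lemma bG_swap {n : ℕ} (d : ℂ) (z : Fin n → ℂ) (σ : Equiv.Perm (Fin n)) (a b : Fin n)
    (hab : a.val + 1 = b.val) :
    bG d z (σ * Equiv.swap a b) * bS d z (σ a) (σ b) = bG d z σ * bS d z (σ b) (σ a) := by
  have hne : a ≠ b := by intro h; rw [h] at hab; omega
  set P := Finset.univ.filter (fun kl : Fin n × Fin n => kl.1 < kl.2) with hP
  have hmem : (a, b) ∈ P := by
    simp only [hP, Finset.mem_filter, Finset.mem_univ, true_and, Fin.lt_def]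
    omega
  have h1 : bG d z σ = bS d z (σ a) (σ b) *
      ∏ kl ∈ P.erase (a, b), bS d z (σ kl.1) (σ kl.2) := by
    unfold bG
    exact (Finset.mul_prod_erase P (fun kl : Fin n × Fin n => bS d z (σ kl.1) (σ kl.2))
      (a := (a, b)) hmem).symm
  have h2 : bG d z (σ * Equiv.swap a b) = bS d z (σ b) (σ a) *
      ∏ kl ∈ P.erase (a, b), bS d z (σ kl.1) (σ kl.2) := by
    unfold bG
    rw [← Finset.mul_prod_erase P
      (fun kl : Fin n × Fin n => bS d z ((σ * Equiv.swap a b) kl.1) ((σ * Equiv.swap a b) kl.2))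
      (a := (a, b))]
    · congr 1
      · simp
      · refine Finset.prod_bij' (fun kl _ => (Equiv.swap a b kl.1, Equiv.swap a b kl.2))
          (fun kl _ => (Equiv.swap a b kl.1, Equiv.swap a b kl.2)) ?_ ?_ ?_ ?_ ?_
        · rintro ⟨i, j⟩ h
          simp only [hP, Finset.mem_erase, Finset.mem_filter, Finset.mem_univ, true_and, ne_eq,
            Prod.mk.injEq, Equiv.swap_apply_def, Fin.ext_iff, Fin.lt_def] at h ⊢
          grind
        · rintro ⟨i, j⟩ h
          simp only [hP, Finset.mem_erase, Finset.mem_filter, Finset.mem_univ, true_and, ne_eq,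
            Prod.mk.injEq, Equiv.swap_apply_def, Fin.ext_iff, Fin.lt_def] at h ⊢
          grind
        · simp
        · simp
        · simp
    · exact hmem
  rw [h1, h2]; ring

lemma bF_collide {n : ℕ} (d : ℂ) (z : Fin n → ℂ) (hz : ∀ i, z i ≠ 0) (x : Fin n → ℤ)
    (a b : Fin n) (hab : a.val + 1 = b.val) (hx : x b = x a + 1) :
    bF d z (x + Pi.single a 1) + bF d z (x + Pi.single b (-1)) = 2 * d * bF d z x := by
  have hne : a ≠ b := by intro h; rw [h] at hab; omega
  have hx' : ∃ y : Fin n → ℤ, y a = y b ∧ x = y + Pi.single b 1 := by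
    refine ⟨x - Pi.single b 1, ?_, by simp⟩
    simp [hne, hx]
  obtain ⟨y, hy, rfl⟩ := hx'
  let T : Equiv.Perm (Fin n) → ℂ := fun σ => ((Equiv.Perm.sign σ : ℤ) : ℂ) * bG d z σ *
        (∏ k, z (σ k) ^ (y k)) * bS d z (σ b) (σ a)
  have hT : ∑ σ, T σ = 0 := by
    have h : ∑ σ, T σ = - ∑ σ, T σ := by
      conv_lhs => rw [← Equiv.sum_comp (Equiv.mulRight (Equiv.swap a b)) T]
      rw [← Finset.sum_neg_distrib]
      refine Finset.sum_congr rfl fun σ _ => ?_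
      have hp : ∏ k, z ((σ * Equiv.swap a b) k) ^ (y k) = ∏ k, z (σ k) ^ (y k) := by
        rw [← Equiv.prod_comp (Equiv.swap a b) (fun k => z (σ k) ^ (y k))]
        refine Finset.prod_congr rfl fun k _ => ?_
        have : y (Equiv.swap a b k) = y k := by
          rw [Equiv.swap_apply_def]
          split_ifs with h1 h2
          · rw [h1, hy]
          · rw [h2, hy]
          · rfl
        rw [this]; rfl
      have hg := bG_swap d z σ a b hab
      simp only [T, Equiv.coe_mulRight]
      rw [hp]
      simp only [Equiv.Perm.sign_mul, Equiv.Perm.sign_swap hne, Equiv.Perm.mul_apply,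
        Equiv.swap_apply_left, Equiv.swap_apply_right]
      push_cast
      linear_combination (-((Equiv.Perm.sign σ : ℤ) : ℂ) * (∏ k, z (σ k) ^ (y k))) * hg
    exact self_eq_neg.mp h
  have e1 : y + Pi.single b 1 + Pi.single b (-1) = y := by
    rw [add_assoc, ← Pi.single_add]; simp
  rw [e1, ← sub_eq_zero, ← hT, bF_add d z hz (y + Pi.single b 1), bF_add d z hz y b 1]
  unfold bF
  rw [Finset.mul_sum, ← Finset.sum_add_distrib, ← Finset.sum_sub_distrib]
  refine Finset.sum_congr rfl fun σ _ => ?_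
  rw [prod_add_single (fun j => z (σ j)) (fun j => hz _)]
  simp only [T, bS, zpow_one]
  ring

lemma bG_eq {n : ℕ} (d : ℂ) (z : Fin n → ℂ) (σ : Equiv.Perm (Fin n)) :
    bG d z σ = ∏ i, ∏ j, if i < j then bS d z (σ i) (σ j) else 1 := by
  unfold bG
  rw [Finset.prod_filter, Fintype.prod_prod_type]

lemma bG_rot {m : ℕ} (d : ℂ) (z : Fin (m+1) → ℂ) (σ : Equiv.Perm (Fin (m+1))) :
    bG d z (σ * finRotate (m+1)) * ∏ j : Fin m, bS d z (σ 0) (σ j.succ) =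
      bG d z σ * ∏ j : Fin m, bS d z (σ j.succ) (σ 0) := by
  rw [bG_eq, bG_eq]
  rw [Fin.prod_univ_castSucc (n := m), Fin.prod_univ_succ (n := m)
    (fun i => ∏ j, if i < j then bS d z (σ i) (σ j) else 1)]
  have h0 : (∏ j, if (0 : Fin (m+1)) < j then bS d z (σ 0) (σ j) else 1) =
      ∏ j : Fin m, bS d z (σ 0) (σ j.succ) := by
    rw [Fin.prod_univ_succ]; simp
  have h1 : ∀ i : Fin m, (∏ j, if i.succ < j then bS d z (σ i.succ) (σ j) else 1) =
     ∏ j : Fin m, if i < j then bS d z (σ i.succ) (σ j.succ) else 1 := by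
    intro i
    rw [Fin.prod_univ_succ]; simp
  have h2 : ∀ i : Fin m, (∏ j, if i.castSucc < j then bS d z ((σ * finRotate (m+1)) i.castSucc) ((σ * finRotate (m+1)) j) else 1) =
     (∏ j : Fin m, if i < j then bS d z (σ i.succ) (σ j.succ) else 1) * bS d z (σ i.succ) (σ 0) := by
    intro i
    rw [Fin.prod_univ_castSucc]; simp [Fin.castSucc_lt_last]
  have h3 : (∏ j, if Fin.last m < j then bS d z ((σ * finRotate (m+1)) (Fin.last m)) ((σ * finRotate (m+1)) j) else 1) = 1 := by
    apply Finset.prod_eq_one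
    intro j _
    rw [if_neg]; exact not_lt.mpr (Fin.le_last j)
  simp only [h0, h1, h2, h3, Finset.prod_mul_distrib, mul_one]
  ring

lemma bF_rot {m : ℕ} (N : ℕ) (d : ℂ) (z : Fin (m+1) → ℂ) (hz : ∀ i, z i ≠ 0)
    (hs : ∀ i j, bS d z i j ≠ 0)
    (hBE : ∀ j, z j ^ N * ∏ k, bS d z k j = (-1) ^ m * ∏ k, bS d z j k)
    (x : Fin (m+1) → ℤ) :
    bF d z (x ∘ finRotate (m+1) + Pi.single (Fin.last m) (N : ℤ)) = bF d z x := by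
  rw [bF_add d z hz]
  rw [← Equiv.sum_comp (Equiv.mulRight (finRotate (m+1)))]
  unfold bF
  refine Finset.sum_congr rfl fun σ _ => ?_
  simp only [Equiv.coe_mulRight]
  have hp : ∏ k, z ((σ * finRotate (m+1)) k) ^ ((x ∘ finRotate (m+1)) k) = ∏ k, z (σ k) ^ (x k) := by
    rw [← Equiv.prod_comp (finRotate (m+1)) (fun k => z (σ k) ^ (x k))]
    rfl
  rw [hp]
  have hb := hBE (σ 0)
  rw [← Equiv.prod_comp σ (fun k => bS d z k (σ 0)), ← Equiv.prod_comp σ (fun k => bS d z (σ 0) k),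
    Fin.prod_univ_succ, Fin.prod_univ_succ] at hb
  have hg := bG_rot d z σ
  have hr : (σ * finRotate (m+1)) (Fin.last m) = σ 0 := by simp
  rw [hr]
  simp only [Equiv.Perm.sign_mul, sign_finRotate]
  push_cast
  set U := ∏ j : Fin m, bS d z (σ 0) (σ j.succ)
  set V := ∏ j : Fin m, bS d z (σ j.succ) (σ 0) with hV
  have hV0 : V ≠ 0 := Finset.prod_ne_zero_iff.mpr fun j _ => hs _ _
  have h0 := hs (σ 0) (σ 0)
  have hb' : z (σ 0) ^ N * V = (-1) ^ m * U := by
    apply mul_left_cancel₀ h0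
    linear_combination hb
  have hm : ((-1 : ℂ) ^ m) * (-1) ^ m = 1 := by rw [← mul_pow]; simp
  apply mul_right_cancel₀ hV0
  rw [zpow_natCast]
  linear_combination (((Equiv.Perm.sign σ : ℤ) : ℂ) * (-1)^m * bG d z (σ * finRotate (m+1)) * ∏ k, z (σ k) ^ (x k)) * hb' + (((Equiv.Perm.sign σ : ℤ) : ℂ) * (∏ k, z (σ k) ^ (x k))) * hg + (((Equiv.Perm.sign σ : ℤ) : ℂ) * bG d z (σ * finRotate (m+1)) * U * ∏ k, z (σ k) ^ (x k)) * hm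

lemma fin_val_add_one {N : ℕ} [NeZero N] (i : Fin N) :
    ((i + 1 : Fin N) : ℕ) = if i.val + 1 < N then i.val + 1 else 0 := by
  rw [Fin.val_add, Fin.val_one']
  have hi := i.isLt
  have : (i.val + 1 % N) % N = (i.val + 1) % N := by simp
  rw [this]
  split_ifs with h
  · exact Nat.mod_eq_of_lt h
  · have : i.val + 1 = N := by omega
    rw [this, Nat.mod_self]

/-- Positions `1..N` as integers. -/
def posZ {N n : ℕ} (x : Fin n → Fin N) : Fin n → ℤ := fun k => (x k : ℤ) + 1

lemma finRotate_val {m : ℕ} (k : Fin (m+1)) :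
    (finRotate (m+1) k : ℕ) = if k.val < m then k.val + 1 else 0 := by
  rw [finRotate_apply, fin_val_add_one]
  simp

lemma psi_eq {N n : ℕ} (Δ : ℝ) (p : Fin n → ℝ) (x : Fin n → Fin N) (hx : StrictMono x) :
    psiVec N n Δ p (Finset.univ.image x) = bF (Δ : ℂ) (zOf p) (posZ x) := by
  have hcard : (Finset.univ.image x).card = n := by
    rw [Finset.card_image_of_injective _ hx.injective]; simp
  unfold psiVec bF
  rw [dif_pos hcard]
  have hu : x = (Finset.univ.image x).orderEmbOfFin hcard :=
    Finset.orderEmbOfFin_unique hcard (fun k => Finset.mem_image_of_mem _ (Finset.mem_univ k)) hx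
  refine Finset.sum_congr rfl fun σ _ => ?_
  congr 1
  · unfold Acoef bG
    congr 1
    refine Finset.prod_congr rfl fun kl _ => ?_
    simp only [Sfun, bS, zOf]
    rw [mul_sub, mul_add, ← Complex.exp_add, ← Complex.exp_add]
    simp
    ring
  · refine Finset.prod_congr rfl fun k _ => ?_
    have : (((Finset.univ.image x).orderIsoOfFin hcard k : Fin N)) = x k := by
      rw [Finset.coe_orderIsoOfFin_apply, ← hu]
    rw [this]
    simp only [zOf, posZ]
    rw [← Complex.exp_int_mul]
    congr 1
    push_cast
    ring

lemma psi_right {N m : ℕ} [NeZero N] (Δ : ℝ) (p : Fin (m+1) → ℝ)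
    (hrot : ∀ x : Fin (m+1) → ℤ, bF (Δ : ℂ) (zOf p)
      (x ∘ finRotate (m+1) + Pi.single (Fin.last m) (N : ℤ)) = bF (Δ : ℂ) (zOf p) x)
    (x : Fin (m+1) → Fin N) (hx : StrictMono x) (k : Fin (m+1))
    (hk : x k + 1 ∉ Finset.univ.image x) :
    psiVec N (m+1) Δ p ((Finset.univ.image x).image (Equiv.swap (x k) (x k + 1))) =
      bF (Δ : ℂ) (zOf p) (posZ x + Pi.single k 1) := by
  have hk' : ∀ j, x j ≠ x k + 1 := fun j h => hk (by rw [← h]; simp)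
  have hsw : ∀ j, j ≠ k → Equiv.swap (x k) (x k + 1) (x j) = x j := fun j hj =>
    Equiv.swap_apply_of_ne_of_ne (fun h => hj (hx.injective h)) (hk' j)
  have hv := fin_val_add_one (x k)
  rw [Finset.image_image]
  by_cases hw : (x k).val + 1 < N
  · rw [if_pos hw] at hv
    let y : Fin (m+1) → Fin N := Function.update x k (x k + 1)
    have hy : StrictMono y := by
      intro i j hij
      have h1 := hx hij
      have h2 := hk' j
      simp only [y, Function.update_apply]
      rw [Ne, Fin.ext_iff] at h2
      rw [Fin.lt_def] at h1
      split_ifs with h3 h4 h4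
      · subst h3; subst h4; exact absurd hij (lt_irrefl _)
      · subst h3; rw [Fin.lt_def]; omega
      · subst h4; rw [Fin.lt_def]; omega
      · exact h1
    have he : (Equiv.swap (x k) (x k + 1)) ∘ x = y := by
      funext j
      by_cases hj : j = k
      · subst hj; simp [y]
      · simp [y, hj, hsw j hj]
    rw [he, psi_eq Δ p y hy]
    congr 1
    funext j
    by_cases hj : j = k
    · subst hj; simp [y, posZ, hv]
    · simp [y, posZ, hj]
  · have hxk : (x k).val + 1 = N := by have := (x k).isLt; omega
    rw [if_neg hw] at hv
    have hkl : k = Fin.last m := by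
      by_contra h
      have := hx (Fin.lt_last_iff_ne_last.mpr h)
      rw [Fin.lt_def] at this
      have := (x (Fin.last m)).isLt
      omega
    subst hkl
    let y : Fin (m+1) → Fin N := Fin.cons (x (Fin.last m) + 1) (fun j => x j.castSucc)
    have hy : StrictMono y := by
      rw [Fin.strictMono_iff_lt_succ]
      intro i
      rcases i with ⟨i, hi⟩
      rcases i with _ | i
      · have h2 := hk' (0 : Fin (m+1))
        rw [Ne, Fin.ext_iff] at h2
        have : y (Fin.succ ⟨0, hi⟩) = x 0 := rfl
        rw [this]
        have : y (Fin.castSucc ⟨0, hi⟩) = x (Fin.last m) + 1 := rfl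
        rw [this, Fin.lt_def]
        omega
      · exact hx (a := ⟨i, by omega⟩) (b := ⟨i+1, by omega⟩) (by simp [Fin.lt_def])
    have hyl : ∀ j : Fin m, y (finRotate (m+1) j.castSucc) = x j.castSucc := by
      intro j
      have : finRotate (m+1) j.castSucc = j.succ := by simp
      rw [this]; simp [y]
    have hy0 : y (finRotate (m+1) (Fin.last m)) = x (Fin.last m) + 1 := by
      have : finRotate (m+1) (Fin.last m) = 0 := by simp
      rw [this]; simp [y]
    have he : (Equiv.swap (x (Fin.last m)) (x (Fin.last m) + 1)) ∘ x = y ∘ finRotate (m+1) := by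
      funext j
      refine Fin.lastCases ?_ (fun j => ?_) j
      · simp only [Function.comp, hy0]; simp
      · simp only [Function.comp, hyl]
        exact hsw _ (Fin.castSucc_lt_last j).ne
    rw [he, ← Finset.image_image, Finset.image_univ_equiv, psi_eq Δ p y hy, ← hrot]
    congr 1
    funext j
    refine Fin.lastCases ?_ (fun j => ?_) j
    · simp only [Pi.add_apply, Function.comp, posZ, hy0, hv, Pi.single_eq_same]
      push_cast
      omega
    · simp only [Pi.add_apply, Function.comp, posZ, hyl]
      rw [Pi.single_eq_of_ne (Fin.castSucc_lt_last j).ne, Pi.single_eq_of_ne (Fin.castSucc_lt_last j).ne]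

lemma psi_left {N m : ℕ} [NeZero N] (Δ : ℝ) (p : Fin (m+1) → ℝ)
    (hrot : ∀ x : Fin (m+1) → ℤ, bF (Δ : ℂ) (zOf p)
      (x ∘ finRotate (m+1) + Pi.single (Fin.last m) (N : ℤ)) = bF (Δ : ℂ) (zOf p) x)
    (x : Fin (m+1) → Fin N) (hx : StrictMono x) (k : Fin (m+1)) (i : Fin N) (hi : i + 1 = x k)
    (hk : i ∉ Finset.univ.image x) :
    psiVec N (m+1) Δ p ((Finset.univ.image x).image (Equiv.swap i (x k))) =
      bF (Δ : ℂ) (zOf p) (posZ x + Pi.single k (-1)) := by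
  have hk' : ∀ j, x j ≠ i := fun j h => hk (by rw [← h]; simp)
  have hsw : ∀ j, j ≠ k → Equiv.swap i (x k) (x j) = x j := fun j hj =>
    Equiv.swap_apply_of_ne_of_ne (hk' j) (fun h => hj (hx.injective h))
  have hv := fin_val_add_one i
  rw [hi] at hv
  rw [Finset.image_image]
  by_cases hw : i.val + 1 < N
  · rw [if_pos hw] at hv
    let y : Fin (m+1) → Fin N := Function.update x k i
    have hy : StrictMono y := by
      intro a j hij
      have h1 := hx hij
      have h2 := hk' a
      simp only [y, Function.update_apply]
      rw [Ne, Fin.ext_iff] at h2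
      rw [Fin.lt_def] at h1
      split_ifs with h3 h4 h4
      · subst h3; subst h4; exact absurd hij (lt_irrefl _)
      · subst h3; rw [Fin.lt_def]; omega
      · subst h4; rw [Fin.lt_def]; omega
      · exact h1
    have he : (Equiv.swap i (x k)) ∘ x = y := by
      funext j
      by_cases hj : j = k
      · subst hj; simp [y]
      · simp [y, hj, hsw j hj]
    rw [he, psi_eq Δ p y hy]
    congr 1
    funext j
    by_cases hj : j = k
    · subst hj; simp [y, posZ, hv]
    · simp [y, posZ, hj]
  · have hxk : i.val + 1 = N := by have := i.isLt; omega
    rw [if_neg hw] at hv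
    have hkl : k = 0 := by
      by_contra h
      have := hx (Fin.pos_iff_ne_zero.mpr h)
      rw [Fin.lt_def] at this
      omega
    subst hkl
    let y : Fin (m+1) → Fin N := Fin.snoc (fun j : Fin m => x j.succ) i
    have hyl : ∀ j : Fin m, y j.castSucc = x j.succ := by
      intro j; simp [y]
    have hy0 : y (Fin.last m) = i := by simp [y]
    have hy : StrictMono y := by
      intro a b
      refine Fin.lastCases ?_ (fun a => ?_) a
      · intro h; exact absurd h (not_lt.mpr (Fin.le_last b))
      · refine Fin.lastCases ?_ (fun b => ?_) b
        · intro _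
          rw [hyl, hy0, Fin.lt_def]
          have h2 := hk' a.succ
          rw [Ne, Fin.ext_iff] at h2
          have := (x a.succ).isLt
          omega
        · intro h
          rw [hyl, hyl]
          exact hx (by simpa using h)
    have he : (Equiv.swap i (x 0)) ∘ x ∘ finRotate (m+1) = y := by
      funext j
      refine Fin.lastCases ?_ (fun j => ?_) j
      · have : finRotate (m+1) (Fin.last m) = 0 := by simp
        simp only [Function.comp, hy0, this]; simp
      · have : finRotate (m+1) j.castSucc = j.succ := by simp
        simp only [Function.comp, hyl, this]
        exact hsw _ (Fin.succ_ne_zero j)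
    have he2 : Finset.univ.image ((Equiv.swap i (x 0)) ∘ x) = Finset.univ.image y := by
      rw [← he, ← Function.comp_assoc, ← Finset.image_image (s := Finset.univ) (f := finRotate (m+1)),
        Finset.image_univ_equiv]
    rw [he2, psi_eq Δ p y hy, ← hrot (posZ x + _)]
    congr 1
    funext j
    refine Fin.lastCases ?_ (fun j => ?_) j
    · have : finRotate (m+1) (Fin.last m) = 0 := by simp
      simp only [Pi.add_apply, Function.comp, posZ, hy0, hv, this, Pi.single_eq_same]
      push_cast
      omega
    · have : finRotate (m+1) j.castSucc = j.succ := by simp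
      simp only [Pi.add_apply, Function.comp, posZ, hyl, this]
      rw [Pi.single_eq_of_ne (Fin.castSucc_lt_last j).ne, Pi.single_eq_of_ne (Fin.succ_ne_zero j)]
      ring

lemma adj_rot {N m : ℕ} [NeZero N] (x : Fin (m+1) → Fin N) (hx : StrictMono x) (k : Fin (m+1))
    (hk : x k + 1 ∈ Finset.univ.image x) : x k + 1 = x (finRotate (m+1) k) := by
  simp only [Finset.mem_image, Finset.mem_univ, true_and] at hk
  obtain ⟨j, hj⟩ := hk
  rw [← hj]
  have hv := fin_val_add_one (x k)
  rw [← hj] at hv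
  have hr := finRotate_val k
  congr 1
  by_cases hw : (x k).val + 1 < N
  · rw [if_pos hw] at hv
    have hkj : k < j := by
      rw [← hx.lt_iff_lt, Fin.lt_def]; omega
    have h2 : k.val < m := by
      rw [Fin.lt_def] at hkj; omega
    rw [if_pos h2] at hr
    by_contra hne
    have h3 : finRotate (m+1) k < j := by
      rw [Fin.lt_def] at hkj ⊢
      rw [Fin.ext_iff] at hne
      omega
    have h4 : k < finRotate (m+1) k := by rw [Fin.lt_def]; omega
    have h5 := hx h3
    have h6 := hx h4
    rw [Fin.lt_def] at h5 h6
    omega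
  · rw [if_neg hw] at hv
    have hkl : k = Fin.last m := by
      by_contra h
      have := hx (Fin.lt_last_iff_ne_last.mpr h)
      rw [Fin.lt_def] at this
      have := (x (Fin.last m)).isLt
      omega
    subst hkl
    by_contra hne
    have h4 : (0 : Fin (m+1)) < j := by
      rw [Fin.pos_iff_ne_zero]
      intro h; apply hne; rw [h]; simp
    have h5 := hx h4
    rw [Fin.lt_def] at h5
    omega

lemma pair_eq {N m : ℕ} [NeZero N] (hN : 2 ≤ N) (d : ℂ) (z : Fin (m+1) → ℂ) (hz : ∀ i, z i ≠ 0)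
    (hrot : ∀ x : Fin (m+1) → ℤ, bF d z
      (x ∘ finRotate (m+1) + Pi.single (Fin.last m) (N : ℤ)) = bF d z x)
    (x : Fin (m+1) → Fin N) (hx : StrictMono x) (k : Fin (m+1))
    (hk : x k + 1 = x (finRotate (m+1) k)) :
    bF d z (posZ x + Pi.single k 1) + bF d z (posZ x + Pi.single (finRotate (m+1) k) (-1)) =
      2 * d * bF d z (posZ x) := by
  have hr := finRotate_val k
  have hv := fin_val_add_one (x k)
  by_cases hkm : k.val < m
  · rw [if_pos hkm] at hr
    refine bF_collide d z hz (posZ x) k _ hr.symm ?_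
    have h4 : k < finRotate (m+1) k := by rw [Fin.lt_def]; omega
    have h6 := hx h4
    rw [Fin.lt_def, ← hk, hv] at h6
    rw [hk] at hv
    split_ifs at hv h6 with hw
    · simp only [posZ, hv]; push_cast; ring
    · omega
  · have hkl : k = Fin.last m := by
      rw [Fin.ext_iff]; simp; omega
    subst hkl
    have h0 : finRotate (m+1) (Fin.last m) = 0 := by simp
    rw [h0] at hk ⊢
    have hle : x 0 ≤ x (Fin.last m) := hx.monotone (Fin.zero_le _)
    rw [Fin.le_def, ← hk, hv] at hle
    rw [hk] at hv
    split_ifs at hv hle with hw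
    · omega
    have hxl : (x (Fin.last m)).val + 1 = N := by
      have := (x (Fin.last m)).isLt; omega
    obtain _ | m := m
    · have : x (Fin.last 0) = x 0 := rfl
      rw [this] at hxl
      omega
    have hl1 : ((Fin.last m).castSucc : Fin (m+1+1)) ≠ Fin.last (m+1) := (Fin.castSucc_lt_last _).ne
    have hR : ∀ j : Fin (m+1), finRotate (m+1+1) j.castSucc = j.succ := by intro j; simp
    have hsl : (Fin.last m).succ = Fin.last (m+1) := rfl
    have key := bF_collide d z hz
      (posZ x ∘ finRotate (m+1+1) + Pi.single (Fin.last (m+1)) (N : ℤ))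
      (Fin.last m).castSucc (Fin.last (m+1)) (by simp) (by
        simp only [Pi.add_apply, Function.comp, h0, hR, Pi.single_eq_same,
          Pi.single_eq_of_ne hl1, hsl, posZ]
        omega)
    have hc : ∀ (k : Fin (m+1+1)) (e : ℤ),
        (Pi.single (finRotate (m+1+1) k) e : Fin (m+1+1) → ℤ) ∘ finRotate (m+1+1) = Pi.single k e := by
      intro k e
      funext j
      simp only [Function.comp, Pi.single_apply, EmbeddingLike.apply_eq_iff_eq]
    have e1 : ∀ (k : Fin (m+1+1)) (e : ℤ), posZ x ∘ finRotate (m+1+1) + Pi.single (Fin.last (m+1)) (N : ℤ)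
        + Pi.single k e = (posZ x + Pi.single (finRotate (m+1+1) k) e) ∘ finRotate (m+1+1)
          + Pi.single (Fin.last (m+1)) (N : ℤ) := by
      intro k e
      rw [← hc k e]
      funext j
      simp only [Pi.add_apply, Function.comp]
      ring
    rw [e1, e1, hrot, hrot, hrot, hR, h0, hsl] at key
    exact key

lemma HX_apply {N : ℕ} [NeZero N] (Δ : ℝ) (v : Finset (Fin N) → ℂ) (A : Finset (Fin N)) :
    (HX N Δ).mulVec v A = (N : ℂ) * Δ / 2 * v A
      + ∑ j ∈ A, (if j + 1 ∉ A then v (A.image (Equiv.swap j (j + 1))) - Δ * v A else 0)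
      + ∑ j ∈ A, (if j - 1 ∉ A then v (A.image (Equiv.swap (j - 1) j)) - Δ * v A else 0) := by
  have h1 : ∀ i : Fin N, (HXi N Δ i).mulVec v A = Δ / 2 * v A
      + (if i ∈ A then if i + 1 ∉ A then v (A.image (Equiv.swap i (i + 1))) - Δ * v A else 0 else 0)
      + (if i + 1 ∈ A then if i ∉ A then v (A.image (Equiv.swap i (i + 1))) - Δ * v A else 0 else 0) := by
    intro i
    simp only [Matrix.mulVec, dotProduct, HXi, Matrix.of_apply]
    have hne : (¬ (i ∈ A ↔ i + 1 ∈ A)) → A ≠ A.image (Equiv.swap i (i+1)) := by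
      intro h he
      apply h
      constructor
      · intro hi
        rw [he]
        exact Finset.mem_image.mpr ⟨i, hi, by simp⟩
      · intro hi
        rw [he]
        exact Finset.mem_image.mpr ⟨i + 1, hi, by simp⟩
    by_cases h : (i ∈ A ↔ i + 1 ∈ A)
    · by_cases hi : i ∈ A
      · have hi' := h.mp hi
        simp [hi, hi']
      · have hi' : i + 1 ∉ A := fun q => hi (h.mpr q)
        simp [hi, hi']
    · have h3 : ∀ B, (if A = B then -((Δ : ℂ) / 2)
          else if B = A.image (Equiv.swap i (i + 1)) then 1 else 0) * v B
          = (if A = B then -((Δ : ℂ) / 2) * v B else 0)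
            + (if B = A.image (Equiv.swap i (i + 1)) then v B else 0) := by
        intro B
        by_cases hB : A = B
        · subst hB
          rw [if_pos rfl, if_pos rfl, if_neg (hne h)]; ring
        · rw [if_neg hB, if_neg hB]
          split_ifs <;> simp
      have hxor : (i ∈ A ∧ i + 1 ∉ A) ∨ (i ∉ A ∧ i + 1 ∈ A) := by tauto
      simp only [h, if_false, not_false_eq_true, true_and]
      rw [Finset.sum_congr rfl fun B _ => h3 B, Finset.sum_add_distrib]
      rcases hxor with ⟨ha, hb⟩ | ⟨ha, hb⟩
      · simp [ha, hb]; ring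
      · simp [ha, hb]; ring
  have h2 : (HX N Δ).mulVec v A = ∑ i, (HXi N Δ i).mulVec v A := by
    unfold HX
    rw [Matrix.sum_mulVec, Finset.sum_apply]
  rw [h2, Finset.sum_congr rfl fun i _ => h1 i, Finset.sum_add_distrib, Finset.sum_add_distrib]
  congr 1
  · congr 1
    · simp; ring
    · simp only [← Finset.sum_filter]
      simp
  · rw [← Equiv.sum_comp (Equiv.subRight (1 : Fin N))]
    simp only [Equiv.subRight_apply, sub_add_cancel]
    rw [← Finset.sum_filter]
    simp

lemma eigen_core {N m : ℕ} [NeZero N] (hN : 2 ≤ N) (Δ : ℝ) (p : Fin (m+1) → ℝ)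
    (hrot : ∀ x : Fin (m+1) → ℤ, bF (Δ : ℂ) (zOf p)
      (x ∘ finRotate (m+1) + Pi.single (Fin.last m) (N : ℤ)) = bF (Δ : ℂ) (zOf p) x)
    (x : Fin (m+1) → Fin N) (hx : StrictMono x) :
    (HX N Δ).mulVec (psiVec N (m+1) Δ p) (Finset.univ.image x) =
      ((N : ℂ) * Δ / 2 + ∑ k, (zOf p k + (zOf p k)⁻¹ - 2 * Δ)) *
        psiVec N (m+1) Δ p (Finset.univ.image x) := by
  have hz : ∀ i, zOf p i ≠ 0 := fun i => Complex.exp_ne_zero _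
  set A := Finset.univ.image x with hA
  set f := bF (Δ : ℂ) (zOf p) with hf
  have hψ : psiVec N (m+1) Δ p A = f (posZ x) := psi_eq Δ p x hx
  have hsum : ∀ g : Fin N → ℂ, ∑ j ∈ A, g j = ∑ k, g (x k) := fun g =>
    Finset.sum_image (fun a _ b _ h => hx.injective h)
  rw [HX_apply, hψ, hsum, hsum]
  have hR : ∀ k, (if x k + 1 ∉ A then psiVec N (m+1) Δ p (A.image (Equiv.swap (x k) (x k + 1)))
      - Δ * f (posZ x) else 0) = (f (posZ x + Pi.single k 1) - Δ * f (posZ x))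
        - (if x k + 1 ∈ A then f (posZ x + Pi.single k 1) - Δ * f (posZ x) else 0) := by
    intro k
    by_cases h : x k + 1 ∈ A
    · simp [h]
    · rw [if_pos h, if_neg h, psi_right Δ p hrot x hx k h]; simp [hf]
  have hL : ∀ k, (if x k - 1 ∉ A then psiVec N (m+1) Δ p (A.image (Equiv.swap (x k - 1) (x k)))
      - Δ * f (posZ x) else 0) = (f (posZ x + Pi.single k (-1)) - Δ * f (posZ x))
        - (if x k - 1 ∈ A then f (posZ x + Pi.single k (-1)) - Δ * f (posZ x) else 0) := by
    intro k
    by_cases h : x k - 1 ∈ A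
    · simp [h]
    · rw [if_pos h, if_neg h, psi_left Δ p hrot x hx k (x k - 1) (by simp) h]; simp [hf]
  rw [Finset.sum_congr rfl fun k _ => hR k, Finset.sum_congr rfl fun k _ => hL k]
  have hiff : ∀ k, x (finRotate (m+1) k) - 1 ∈ A ↔ x k + 1 ∈ A := by
    intro k
    constructor
    · intro h
      rw [hA, Finset.mem_image] at h
      obtain ⟨j, -, hj⟩ := h
      have h1 : x j + 1 = x (finRotate (m+1) k) := by rw [hj]; simp
      have h2 := adj_rot x hx j (by rw [h1]; simp)
      have h3 : j = k := (finRotate (m+1)).injective (hx.injective (h2.symm.trans h1))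
      rw [← h3, h1, hA]; simp
    · intro h
      rw [← adj_rot x hx k h, hA]; simp
  have hzero : ∑ k, (if x k + 1 ∈ A then f (posZ x + Pi.single k 1) - Δ * f (posZ x) else 0)
      + ∑ k, (if x k - 1 ∈ A then f (posZ x + Pi.single k (-1)) - Δ * f (posZ x) else 0) = 0 := by
    have hh : ∑ k, (if x k - 1 ∈ A then f (posZ x + Pi.single k (-1)) - Δ * f (posZ x) else 0)
        = ∑ k, (if x (finRotate (m+1) k) - 1 ∈ A then
          f (posZ x + Pi.single (finRotate (m+1) k) (-1)) - Δ * f (posZ x) else 0) :=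
      (Equiv.sum_comp (finRotate (m+1)) (fun k => if x k - 1 ∈ A then
        f (posZ x + (Pi.single k (-1) : Fin (m+1) → ℤ)) - Δ * f (posZ x) else 0)).symm
    rw [hh, ← Finset.sum_add_distrib]
    refine Finset.sum_eq_zero fun k _ => ?_
    simp only [hiff]
    split_ifs with h
    · have := pair_eq hN Δ (zOf p) hz hrot x hx k (adj_rot x hx k h)
      linear_combination this
    · simp
  have hlap := bF_laplace Δ (zOf p) hz (posZ x)
  rw [← hf] at hlap
  simp only [Finset.sum_sub_distrib, Finset.sum_add_distrib] at hlap hzero ⊢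
  simp only [Finset.sum_const, Finset.card_univ, Fintype.card_fin, nsmul_eq_mul] at hlap hzero ⊢
  linear_combination hlap - hzero

lemma psi_of_card {N n : ℕ} (Δ : ℝ) (p : Fin n → ℝ) (A : Finset (Fin N)) (h : A.card ≠ n) :
    psiVec N n Δ p A = 0 := by
  unfold psiVec
  rw [dif_neg h]

lemma eigen_card {N n : ℕ} [NeZero N] (Δ : ℝ) (p : Fin n → ℝ) (A : Finset (Fin N))
    (h : A.card ≠ n) : (HX N Δ).mulVec (psiVec N n Δ p) A = 0 := by
  have h1 : ∀ i j : Fin N, psiVec N n Δ p (A.image (Equiv.swap i j)) = 0 := by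
    intro i j
    apply psi_of_card
    rwa [Finset.card_image_of_injective _ (Equiv.injective _)]
  rw [HX_apply]
  simp [h1, psi_of_card Δ p A h]

/-- **The Bethe ansatz vector is an eigenvector of the XXZ Hamiltonian.** -/
theorem bethe_ansatz_XXZ
    (N n : ℕ) [NeZero N] (hn : 2 * n ≤ N)
    (c : ℝ) (hc : 0 < c) (Δ : ℝ) (hΔ : Δ = (2 - c ^ 2) / 2)
    (Θ : ℝ → ℝ → ℝ)
    (hΘcont : ContinuousOn (fun q : ℝ × ℝ => Θ q.1 q.2) (Ddom Δ ×ˢ Ddom Δ))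
    (hΘzero : Θ 0 0 = 0)
    (hΘ : ∀ a ∈ Ddom Δ, ∀ b ∈ Ddom Δ,
      Complex.exp (-(Complex.I * (Θ a b : ℂ))) =
        Complex.exp (Complex.I * ((a : ℂ) - (b : ℂ))) * Sfun Δ a b / Sfun Δ b a)
    (p : Fin n → ℝ) (hpD : ∀ j, p j ∈ Ddom Δ)
    (hdistinct : Function.Injective p)
    (hBE : ∀ j, Complex.exp (Complex.I * (N : ℂ) * (p j : ℂ)) =
      (-1 : ℂ) ^ (n - 1) *
        Complex.exp (-(Complex.I * ((∑ k, Θ (p j) (p k) : ℝ) : ℂ))))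
    :
    (HX N Δ).mulVec (psiVec N n Δ p) =
      ((N : ℂ) * (Δ : ℂ) / 2 - 2 * ((∑ k, (Δ - Real.cos (p k)) : ℝ) : ℂ)) •
        psiVec N n Δ p := by
  have hcosz : ∀ k, zOf p k + (zOf p k)⁻¹ - 2 * Δ = -2 * ((Δ - Real.cos (p k) : ℝ) : ℂ) := by
    intro k
    have h1 : (Real.cos (p k) : ℂ) = (zOf p k + (zOf p k)⁻¹) / 2 := by
      rw [Complex.ofReal_cos, Complex.cos, zOf, ← Complex.exp_neg]
      congr 3 <;> ring_nf
    push_cast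
    rw [← Complex.ofReal_cos, h1]
    ring
  have hE : (N : ℂ) * (Δ : ℂ) / 2 - 2 * ((∑ k, (Δ - Real.cos (p k)) : ℝ) : ℂ) =
      (N : ℂ) * Δ / 2 + ∑ k, (zOf p k + (zOf p k)⁻¹ - 2 * Δ) := by
    rw [Finset.sum_congr rfl fun k _ => hcosz k, ← Finset.mul_sum, Complex.ofReal_sum]
    ring
  rw [hE]
  funext A
  rw [Pi.smul_apply, smul_eq_mul]
  by_cases hA : A.card = n
  swap
  · rw [eigen_card Δ p A hA, psi_of_card Δ p A hA, mul_zero]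
  obtain _ | m := n
  · rw [Finset.card_eq_zero] at hA
    subst hA
    rw [HX_apply]
    simp
  have hS : ∀ i j, Sfun Δ (p i) (p j) ≠ 0 := by
    intro i j h
    have := hΘ (p i) (hpD i) (p j) (hpD j)
    rw [h, mul_zero, zero_div] at this
    exact Complex.exp_ne_zero _ this
  have hbS : ∀ i j, bS (Δ : ℂ) (zOf p) i j = zOf p i * Sfun Δ (p i) (p j) := by
    intro i j
    simp only [Sfun, bS, zOf]
    rw [mul_sub, mul_add, ← Complex.exp_add, ← Complex.exp_add]
    simp
    ring
  have hz : ∀ i, zOf p i ≠ 0 := fun i => Complex.exp_ne_zero _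
  have hs : ∀ i j, bS (Δ : ℂ) (zOf p) i j ≠ 0 := fun i j => by
    rw [hbS]; exact mul_ne_zero (hz i) (hS i j)
  have hrot := bF_rot N (Δ : ℂ) (zOf p) hz hs (by
    intro j
    have h1 : zOf p j ^ N = Complex.exp (Complex.I * (N : ℂ) * (p j : ℂ)) := by
      rw [zOf, ← Complex.exp_nat_mul]; congr 1; ring
    have h2 : Complex.exp (-(Complex.I * ((∑ k, Θ (p j) (p k) : ℝ) : ℂ))) =
        ∏ k, (bS (Δ : ℂ) (zOf p) j k / bS (Δ : ℂ) (zOf p) k j) := by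
      rw [Complex.ofReal_sum, Finset.mul_sum, ← Finset.sum_neg_distrib, Complex.exp_sum]
      refine Finset.prod_congr rfl fun k _ => ?_
      rw [hΘ _ (hpD j) _ (hpD k), hbS, hbS, mul_sub, Complex.exp_sub]
      simp only [zOf]
      rw [div_mul_eq_mul_div, div_div]
    rw [h1, hBE j, h2, Finset.prod_div_distrib, mul_assoc, div_mul_cancel₀]
    · simp
    · exact Finset.prod_ne_zero_iff.mpr fun k _ => hs _ _)
  have hx : Finset.univ.image (A.orderEmbOfFin hA) = A := by
    ext a
    have := Set.ext_iff.mp (Finset.range_orderEmbOfFin A hA) a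
    simpa using this
  have := eigen_core (by omega) Δ p hrot (A.orderEmbOfFin hA) (A.orderEmbOfFin hA).strictMono
  rwa [hx] at this
end
end

section
/- Assume 1 ≤ n ≤ N/2 and that p₁,…,pₙ ∈ D_Δ are distinct and satisfy the Bethe equations. Fix 1 ≤ x₁ < … < xₙ ≤ N and set x₀ = xₙ − N. Then the coordinate of Vψ along Ψ_x satisfies (Vψ)(x) = Σ_{σ∈S_n} A_σ R_σ, where R_σ = Σ c^{P(Ψ_x,Ψ_y)} Π_{k=1}^n z_{σ(k)}^{y_k}, the sum ranging over integer tuples (y₁,…,yₙ) with x₀ ≤ y₁ ≤ x₁ ≤ y₂ ≤ … ≤ x_{n−1} ≤ yₙ ≤ xₙ whose entries are pairwise distinct modulo N, and c^{P(Ψ_x,Ψ_y)} := Π_{k=1}^n c^{2·1[y_k ∉ {x_{k−1},x_k}]}. -/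
open scoped BigOperators
open Complex

noncomputable section

/-- Positions (in `{1, …, N}`) of a subset of `Fin N`, in increasing order. -/
def posList {N : ℕ} (A : Finset (Fin N)) : List ℕ :=
  (A.sort (· ≤ ·)).map (fun i => (i : ℕ) + 1)

/-- `a₁ ≤ b₁ ≤ a₂ ≤ b₂ ≤ … ≤ aₙ ≤ bₙ` for two lists of the same length. -/
def seqInterlace (a b : List ℕ) : Prop :=
  ∀ i, i < a.length →
    (a.getD i 0 ≤ b.getD i 0 ∧ (i + 1 < a.length → b.getD i 0 ≤ a.getD (i + 1) 0))

/-- Interlacement of two subsets of `{1, …, N}`. -/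
def Interlaced {N : ℕ} (A B : Finset (Fin N)) : Prop :=
  A.card = B.card ∧
    (seqInterlace (posList A) (posList B) ∨ seqInterlace (posList B) (posList A))

/-- `P(Ψ_x, Ψ_y)`, the number of positions at which `Ψ_x` and `Ψ_y` differ. -/
def Pdiff {N : ℕ} (A B : Finset (Fin N)) : ℕ := (symmDiff A B).card

open scoped Classical in
/-- The transfer matrix `V` of the six-vertex model (case `a = b = 1`). -/
def transferV (N : ℕ) (c : ℝ) : Matrix (Finset (Fin N)) (Finset (Fin N)) ℂ :=
  Matrix.of fun A B =>
    if A = B then 2 else if Interlaced A B then (c : ℂ) ^ (Pdiff A B) else 0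

open scoped Classical in
/-- `R_σ`: the sum of `c^{P(Ψ_x, Ψ_y)} ∏_k z_{σ(k)}^{y_k}` over integer tuples
`x₀ ≤ y₁ ≤ x₁ ≤ y₂ ≤ … ≤ x_{n-1} ≤ yₙ ≤ xₙ` with entries pairwise distinct mod `N`. -/
def Rsum {n : ℕ} (N : ℕ) (c : ℝ) (x : ℕ → ℤ) (z : Fin n → ℂ)
    (σ : Equiv.Perm (Fin n)) : ℂ :=
  ∑ y ∈ (Fintype.piFinset fun _ : Fin n => Finset.Icc (x 0) (x n)).filter
      (fun y : Fin n → ℤ =>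
        (∀ k : Fin n, x (k : ℕ) ≤ y k ∧ y k ≤ x ((k : ℕ) + 1)) ∧
        ∀ k l : Fin n, k ≠ l → ¬ ((N : ℤ) ∣ (y k - y l))),
    (∏ k : Fin n, if y k = x (k : ℕ) ∨ y k = x ((k : ℕ) + 1) then 1 else (c : ℂ) ^ 2) *
      ∏ k : Fin n, z (σ k) ^ (y k)

open scoped Classical in
/-- The subset of `Fin N` whose set of positions (in `{1, …, N}`) is `{x 1, …, x n}`. -/
def finsetOfX (N n : ℕ) (x : ℕ → ℤ) : Finset (Fin N) :=
  Finset.univ.filter fun i : Fin N => ∃ k, 1 ≤ k ∧ k ≤ n ∧ x k = (i : ℕ) + 1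


lemma aux_prod_pairs_succ {m : ℕ} (f : Fin (m+1) → Fin (m+1) → ℂ) :
    ∏ kl ∈ Finset.univ.filter (fun kl : Fin (m+1) × Fin (m+1) => kl.1 < kl.2), f kl.1 kl.2
      = (∏ j : Fin m, f 0 j.succ) *
        ∏ k : Fin m, ∏ l : Fin m, if k < l then f k.succ l.succ else 1 := by
  rw [Finset.prod_filter, Fintype.prod_prod_type]
  rw [Fin.prod_univ_succ]
  congr 1
  · rw [Fin.prod_univ_succ]
    simp
  · refine Finset.prod_congr rfl fun k _ => ?_
    rw [Fin.prod_univ_succ]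
    simp

lemma aux_prod_pairs_castSucc {m : ℕ} (f : Fin (m+1) → Fin (m+1) → ℂ) :
    ∏ kl ∈ Finset.univ.filter (fun kl : Fin (m+1) × Fin (m+1) => kl.1 < kl.2), f kl.1 kl.2
      = (∏ j : Fin m, f j.castSucc (Fin.last m)) *
        ∏ k : Fin m, ∏ l : Fin m, if k < l then f k.castSucc l.castSucc else 1 := by
  rw [Finset.prod_filter, Fintype.prod_prod_type]
  rw [Fin.prod_univ_castSucc]
  have h1 : ∏ y : Fin (m+1), (if Fin.last m < y then f (Fin.last m) y else 1) = 1 := by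
    refine Finset.prod_eq_one fun y _ => ?_
    rw [if_neg (not_lt.mpr (Fin.le_last y))]
  simp only [h1, mul_one]
  rw [← Finset.prod_mul_distrib]
  refine Finset.prod_congr rfl fun k _ => ?_
  rw [Fin.prod_univ_castSucc]
  simp [Fin.castSucc_lt_last, mul_comm]

lemma aux_rot_castSucc {m : ℕ} (j : Fin m) : finRotate (m+1) j.castSucc = j.succ := by
  have := finRotate_of_lt (n := m) (k := j) j.2
  exact this

lemma aux_Acoef_rot {m N : ℕ} (Δ : ℝ) (Θ : ℝ → ℝ → ℝ)
    (hΘ : ∀ a ∈ Ddom Δ, ∀ b ∈ Ddom Δ,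
      Complex.exp (-(Complex.I * (Θ a b : ℂ))) =
        Complex.exp (Complex.I * ((a : ℂ) - (b : ℂ))) * Sfun Δ a b / Sfun Δ b a)
    (p : Fin (m+1) → ℝ) (hpD : ∀ j, p j ∈ Ddom Δ)
    (hBE : ∀ j, Complex.exp (Complex.I * (N : ℂ) * (p j : ℂ)) =
      (-1 : ℂ) ^ (m + 1 - 1) *
        Complex.exp (-(Complex.I * ((∑ k, Θ (p j) (p k) : ℝ) : ℂ))))
    (σ : Equiv.Perm (Fin (m+1))) :
    Acoef Δ p (σ * finRotate (m+1)) * zOf p (σ 0) ^ N = Acoef Δ p σ := by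
  set h : Fin (m+1) → Fin (m+1) → ℂ := fun i j =>
    Complex.exp (Complex.I * (p i : ℂ)) * Sfun Δ (p i) (p j) with hh
  have hS : ∀ i j, Sfun Δ (p i) (p j) ≠ 0 := by
    intro i j h0
    have := hΘ (p j) (hpD j) (p i) (hpD i)
    rw [h0, div_zero] at this
    exact Complex.exp_ne_zero _ this
  have hne : ∀ i j, h i j ≠ 0 := fun i j => mul_ne_zero (Complex.exp_ne_zero _) (hS i j)
  have hE : ∀ i j, Complex.exp (-(Complex.I * (Θ (p i) (p j) : ℂ))) = h i j / h j i := by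
    intro i j
    rw [hΘ _ (hpD i) _ (hpD j), mul_sub, Complex.exp_sub]
    simp only [hh]
    have := hS j i
    field_simp
  have hz : zOf p (σ 0) ^ N = (-1) ^ m * ∏ j : Fin m, (h (σ 0) (σ j.succ) / h (σ j.succ) (σ 0)) := by
    have h1 : zOf p (σ 0) ^ N = Complex.exp (Complex.I * (N : ℂ) * (p (σ 0) : ℂ)) := by
      rw [zOf, ← Complex.exp_nat_mul]
      congr 1; ring
    rw [h1, hBE, Nat.add_sub_cancel]
    congr 1
    have h2 : -(Complex.I * ((∑ k, Θ (p (σ 0)) (p k) : ℝ) : ℂ))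
        = ∑ k, -(Complex.I * (Θ (p (σ 0)) (p k) : ℂ)) := by
      push_cast
      rw [Finset.mul_sum, Finset.sum_neg_distrib]
    rw [h2, Complex.exp_sum]
    simp only [hE]
    rw [← Equiv.prod_comp σ, Fin.prod_univ_succ, div_self (hne _ _), one_mul]
  have hA : ∀ τ : Equiv.Perm (Fin (m+1)), Acoef Δ p τ = ((Equiv.Perm.sign τ : ℤ) : ℂ) *
    ∏ kl ∈ Finset.univ.filter (fun kl : Fin (m+1) × Fin (m+1) => kl.1 < kl.2),
      h (τ kl.1) (τ kl.2) := fun τ => rfl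
  rw [hA, hA, aux_prod_pairs_succ (fun k l => h (σ k) (σ l)),
    aux_prod_pairs_castSucc (fun k l => h ((σ * finRotate (m+1)) k) ((σ * finRotate (m+1)) l)), hz]
  simp only [Equiv.Perm.mul_apply, aux_rot_castSucc, finRotate_last, Equiv.Perm.sign_mul,
    sign_finRotate, Nat.add_sub_cancel, Finset.prod_div_distrib]
  have hP : ∏ j : Fin m, h (σ j.succ) (σ 0) ≠ 0 := Finset.prod_ne_zero_iff.mpr fun j _ => hne _ _
  have hsq : ((-1:ℂ)^m) * (-1)^m = 1 := by rw [← mul_pow]; simp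
  push_cast
  field_simp
  linear_combination (∏ j : Fin m, h (σ 0) (σ j.succ)) * (∏ k : Fin m, ∏ l : Fin m, if k < l then h (σ k.succ) (σ l.succ) else 1) * hsq

/-- The Bethe wave function on arbitrary integer tuples. -/
def auxG {n : ℕ} (Δ : ℝ) (p : Fin n → ℝ) (y : Fin n → ℤ) : ℂ :=
  ∑ σ : Equiv.Perm (Fin n), Acoef Δ p σ * ∏ k : Fin n, zOf p (σ k) ^ (y k)

/-- Move the first entry to the end, shifted by `N`. -/
def auxRot {m : ℕ} (N : ℕ) (y : Fin (m+1) → ℤ) : Fin (m+1) → ℤ :=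
  Fin.snoc (α := fun _ => ℤ) (fun j : Fin m => y j.succ) (y 0 + N)

/-- The inverse of `auxRot`. -/
def auxUnrot {m : ℕ} (N : ℕ) (y : Fin (m+1) → ℤ) : Fin (m+1) → ℤ :=
  Fin.cons (α := fun _ => ℤ) (y (Fin.last m) - N) (fun j : Fin m => y j.castSucc)

lemma auxRot_castSucc {m : ℕ} (N : ℕ) (y : Fin (m+1) → ℤ) (j : Fin m) :
    auxRot N y j.castSucc = y j.succ := by simp [auxRot]
lemma auxRot_last {m : ℕ} (N : ℕ) (y : Fin (m+1) → ℤ) :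
    auxRot N y (Fin.last m) = y 0 + N := by simp [auxRot]
lemma auxUnrot_succ {m : ℕ} (N : ℕ) (y : Fin (m+1) → ℤ) (j : Fin m) :
    auxUnrot N y j.succ = y j.castSucc := by simp [auxUnrot]
lemma auxUnrot_zero {m : ℕ} (N : ℕ) (y : Fin (m+1) → ℤ) :
    auxUnrot N y 0 = y (Fin.last m) - N := by simp [auxUnrot]
lemma auxUnrot_rot {m : ℕ} (N : ℕ) (y : Fin (m+1) → ℤ) : auxUnrot N (auxRot N y) = y := by
  funext k
  refine Fin.cases ?_ (fun j => ?_) k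
  · rw [auxUnrot_zero, auxRot_last]; ring
  · rw [auxUnrot_succ, auxRot_castSucc]
lemma auxRot_unrot {m : ℕ} (N : ℕ) (y : Fin (m+1) → ℤ) : auxRot N (auxUnrot N y) = y := by
  funext k
  refine Fin.lastCases ?_ (fun j => ?_) k
  · rw [auxRot_last, auxUnrot_zero]; ring
  · rw [auxRot_castSucc, auxUnrot_succ]

lemma auxG_rot {m N : ℕ} (Δ : ℝ) (p : Fin (m+1) → ℝ)
    (hA : ∀ σ, Acoef Δ p (σ * finRotate (m+1)) * zOf p (σ 0) ^ N = Acoef Δ p σ)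
    (y : Fin (m+1) → ℤ) : auxG Δ p (auxRot N y) = auxG Δ p y := by
  unfold auxG
  rw [← Equiv.sum_comp (Equiv.mulRight (finRotate (m+1)))]
  refine Finset.sum_congr rfl fun σ _ => ?_
  have hz : zOf p (σ 0) ≠ 0 := Complex.exp_ne_zero _
  rw [← hA σ, Fin.prod_univ_castSucc, Fin.prod_univ_succ]
  simp only [Equiv.coe_mulRight, Equiv.Perm.mul_apply, aux_rot_castSucc, finRotate_last,
    auxRot_castSucc, auxRot_last, zpow_add₀ hz, zpow_natCast]
  ring

/-- Integer positions of a subset. -/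
def auxB {N n : ℕ} (B : Finset (Fin N)) (h : B.card = n) : Fin n → ℤ :=
  fun k => ((B.orderEmbOfFin h k : Fin N) : ℕ) + 1

lemma auxB_strictMono {N n : ℕ} (B : Finset (Fin N)) (h : B.card = n) : StrictMono (auxB B h) := by
  intro i j hij
  have : (B.orderEmbOfFin h i) < B.orderEmbOfFin h j := (B.orderEmbOfFin h).strictMono hij
  have := Fin.lt_def.mp this
  simp only [auxB]
  omega

lemma psiVec_eq {N n : ℕ} (Δ : ℝ) (p : Fin n → ℝ) (B : Finset (Fin N)) (h : B.card = n) :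
    psiVec N n Δ p B = auxG Δ p (auxB B h) := by
  unfold psiVec auxG
  rw [dif_pos h]
  refine Finset.sum_congr rfl fun σ _ => ?_
  congr 1
  refine Finset.prod_congr rfl fun k _ => ?_
  rw [zOf, ← Complex.exp_int_mul]
  congr 1
  simp only [auxB, Finset.coe_orderIsoOfFin_apply]
  push_cast
  ring

lemma posList_eq {N : ℕ} (B : Finset (Fin N)) :
    posList B = (B.sort (· ≤ ·)).map (fun i : Fin N => (i : ℕ) + 1) := by
  unfold posList
  generalize (B.sort (· ≤ ·)) = l
  induction l with
  | nil => rfl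
  | cons a l ih => simpa using ih

lemma posList_getD {N n : ℕ} (B : Finset (Fin N)) (h : B.card = n) (k : Fin n) :
    (((posList B).getD k 0 : ℕ) : ℤ) = auxB B h k := by
  have hk : (k : ℕ) < (posList B).length := by simp [posList, h]
  rw [List.getD_eq_getElem _ _ hk]
  simp only [posList_eq, List.getElem_map, auxB, Finset.orderEmbOfFin_apply]
  push_cast
  rfl

lemma posList_length {N n : ℕ} (B : Finset (Fin N)) (h : B.card = n) :
    (posList B).length = n := by simp [posList, h]

lemma seqInterlace_iff {N m : ℕ} (A B : Finset (Fin N)) (hA : A.card = m+1) (hB : B.card = m+1) :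
    seqInterlace (posList A) (posList B) ↔
      (∀ k, auxB A hA k ≤ auxB B hB k) ∧ ∀ j : Fin m, auxB B hB j.castSucc ≤ auxB A hA j.succ := by
  unfold seqInterlace
  rw [posList_length A hA]
  constructor
  · intro H
    refine ⟨fun k => ?_, fun j => ?_⟩
    · rw [← posList_getD, ← posList_getD]
      exact_mod_cast (H k k.2).1
    · rw [← posList_getD, ← posList_getD]
      have := (H j (by omega)).2 (by omega)
      exact_mod_cast this
  · rintro ⟨H1, H2⟩ i hi
    refine ⟨?_, fun hi' => ?_⟩
    · have := H1 ⟨i, hi⟩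
      rw [← posList_getD, ← posList_getD] at this
      exact_mod_cast this
    · have := H2 ⟨i, by omega⟩
      rw [← posList_getD, ← posList_getD] at this
      exact_mod_cast this

open scoped Classical in
/-- The subset with given positions. -/
def auxSet {n : ℕ} (N : ℕ) (y : Fin n → ℤ) : Finset (Fin N) :=
  Finset.univ.filter fun i : Fin N => ∃ k, y k = (i : ℕ) + 1

lemma mem_auxSet {N n : ℕ} (y : Fin n → ℤ) (i : Fin N) :
    i ∈ auxSet N y ↔ ∃ k, y k = (i : ℕ) + 1 := by
  simp only [auxSet, Finset.mem_filter, Finset.mem_univ, true_and]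

lemma auxSet_auxB {N n : ℕ} (B : Finset (Fin N)) (h : B.card = n) : auxSet N (auxB B h) = B := by
  ext i
  rw [mem_auxSet]
  simp only [auxB]
  constructor
  · rintro ⟨k, hk⟩
    have : B.orderEmbOfFin h k = i := by ext; omega
    rw [← this]; exact Finset.orderEmbOfFin_mem _ _ _
  · intro hi
    have : i ∈ Set.range (B.orderEmbOfFin h) := by rw [Finset.range_orderEmbOfFin]; exact hi
    obtain ⟨k, hk⟩ := this
    exact ⟨k, by rw [hk]⟩

lemma auxSet_spec {N n : ℕ} (y : Fin n → ℤ) (hy : StrictMono y) (h1 : ∀ k, 1 ≤ y k ∧ y k ≤ N) :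
    ∃ h : (auxSet N y).card = n, auxB (auxSet N y) h = y := by
  classical
  let f : Fin n → Fin N := fun k => ⟨(y k - 1).toNat, by have := h1 k; omega⟩
  have hf : ∀ k, ((f k : ℕ) : ℤ) + 1 = y k := by
    intro k; have := h1 k; simp only [f]; omega
  have hfm : StrictMono f := by
    intro i j hij
    have := hy hij
    have a1 := hf i; have a2 := hf j
    rw [Fin.lt_def]; omega
  have hs : auxSet N y = Finset.univ.image f := by
    ext i
    simp only [auxSet, Finset.mem_filter, Finset.mem_univ, true_and, Finset.mem_image]
    refine exists_congr fun k => ?_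
    have := hf k
    constructor
    · intro h; ext; omega
    · rintro rfl; omega
  have hc : (auxSet N y).card = n := by
    rw [hs, Finset.card_image_of_injective _ hfm.injective]; simp
  refine ⟨hc, ?_⟩
  have := Finset.orderEmbOfFin_unique hc (f := f) (fun k => by rw [hs]; simp) hfm
  funext k
  simp only [auxB, ← this]
  exact hf k

lemma aux_cpow {N n : ℕ} (c : ℝ) (A B : Finset (Fin N)) (hA : A.card = n) (hB : B.card = n) :
    (c : ℂ) ^ Pdiff A B =
      ∏ k, if auxB B hB k ∈ Set.range (auxB A hA) then (1:ℂ) else (c : ℂ) ^ 2 := by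
  classical
  have hmem : ∀ k, auxB B hB k ∈ Set.range (auxB A hA) ↔ B.orderEmbOfFin hB k ∈ A := by
    intro k
    conv_rhs => rw [← auxSet_auxB A hA]
    simp only [auxSet, Finset.mem_filter, Finset.mem_univ, true_and]
    rfl
  have h1 : Pdiff A B = 2 * (B \ A).card := by
    unfold Pdiff
    rw [symmDiff_def, Finset.sup_eq_union, Finset.card_union_of_disjoint disjoint_sdiff_sdiff,
      Finset.card_sdiff_comm (hA.trans hB.symm)]
    ring
  have h2 : (B \ A).card = (Finset.univ.filter fun k => ¬ B.orderEmbOfFin hB k ∈ A).card := by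
    rw [← Finset.card_map (B.orderEmbOfFin hB).toEmbedding]
    congr 1
    ext i
    simp only [Finset.mem_sdiff, Finset.mem_map, Finset.mem_filter, Finset.mem_univ, true_and]
    constructor
    · rintro ⟨hi, hiA⟩
      have : i ∈ Set.range (B.orderEmbOfFin hB) := by rw [Finset.range_orderEmbOfFin]; exact hi
      obtain ⟨k, hk⟩ := this
      exact ⟨k, by rw [hk]; exact hiA, hk⟩
    · rintro ⟨k, hk, rfl⟩
      exact ⟨Finset.orderEmbOfFin_mem _ _ _, hk⟩
  rw [h1, h2, pow_mul]
  simp only [hmem]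
  rw [Finset.prod_ite]
  simp

lemma aux_sum_card {N n : ℕ} (F : (Fin n → ℤ) → ℂ) (f : Finset (Fin N) → ℂ)
    (h0 : ∀ B, B.card ≠ n → f B = 0) (h1 : ∀ B (h : B.card = n), f B = F (auxB B h)) :
    ∑ B, f B = ∑ y ∈ (Fintype.piFinset fun _ : Fin n => Finset.Icc (1:ℤ) N).filter StrictMono,
      F y := by
  classical
  rw [← Finset.sum_filter_of_ne (p := fun B : Finset (Fin N) => B.card = n)
    (fun B _ hB => by by_contra h; exact hB (h0 B h))]
  refine Finset.sum_bij' (fun B hB => auxB B (Finset.mem_filter.mp hB).2) (fun y _ => auxSet N y)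
    ?_ ?_ ?_ ?_ ?_
  · intro B hB
    rw [Finset.mem_filter, Fintype.mem_piFinset]
    refine ⟨fun k => ?_, auxB_strictMono _ _⟩
    rw [Finset.mem_Icc]
    simp only [auxB]
    omega
  · intro y hy
    rw [Finset.mem_filter, Fintype.mem_piFinset] at hy
    obtain ⟨h, _⟩ := auxSet_spec y hy.2 (fun k => Finset.mem_Icc.mp (hy.1 k))
    exact Finset.mem_filter.mpr ⟨Finset.mem_univ _, h⟩
  · intro B hB; exact auxSet_auxB _ _
  · intro y hy
    rw [Finset.mem_filter, Fintype.mem_piFinset] at hy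
    obtain ⟨h, h'⟩ := auxSet_spec y hy.2 (fun k => Finset.mem_Icc.mp (hy.1 k))
    exact h'
  · intro B hB; exact h1 _ _

open scoped Classical in
/-- The weight of a tuple `y` relative to `a`. -/
def auxW {n : ℕ} (c : ℝ) (a y : Fin n → ℤ) : ℂ :=
  ∏ k, if y k ∈ Set.range a then (1:ℂ) else (c : ℂ) ^ 2

open scoped Classical in
lemma aux_V {N m : ℕ} (c : ℝ) (A B : Finset (Fin N)) (hA : A.card = m+1) (hB : B.card = m+1) :
    transferV N c A B =
      (if (∀ k, auxB B hB k ≤ auxB A hA k) ∧ ∀ j : Fin m, auxB A hA j.castSucc ≤ auxB B hB j.succ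
        then auxW c (auxB A hA) (auxB B hB) else 0) +
      (if (∀ k, auxB A hA k ≤ auxB B hB k) ∧ ∀ j : Fin m, auxB B hB j.castSucc ≤ auxB A hA j.succ
        then auxW c (auxB A hA) (auxB B hB) else 0) := by
  have hW : auxW c (auxB A hA) (auxB B hB) = (c : ℂ) ^ Pdiff A B := by
    rw [aux_cpow c A B hA hB]; unfold auxW
    exact Finset.prod_congr rfl fun k _ => by congr
  simp only [hW, ← seqInterlace_iff]
  have hboth : seqInterlace (posList A) (posList B) → seqInterlace (posList B) (posList A) →
      A = B := by
    intro h1 h2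
    rw [seqInterlace_iff _ _ hA hB] at h1
    rw [seqInterlace_iff _ _ hB hA] at h2
    rw [← auxSet_auxB A hA, ← auxSet_auxB B hB]
    congr 1
    funext k
    exact le_antisymm (h1.1 k) (h2.1 k)
  have hself : seqInterlace (posList A) (posList A) := by
    rw [seqInterlace_iff _ _ hA hA]
    exact ⟨fun k => le_rfl, fun j => (auxB_strictMono A hA (Fin.castSucc_lt_succ)).le⟩
  simp only [transferV, Matrix.of_apply]
  by_cases hAB : A = B
  · subst hAB
    simp only [if_true, hself, Pdiff, symmDiff_self]
    norm_num
  · rw [if_neg hAB]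
    unfold Interlaced
    by_cases h1 : seqInterlace (posList A) (posList B) <;>
      by_cases h2 : seqInterlace (posList B) (posList A)
    · exact absurd (hboth h1 h2) hAB
    all_goals simp [h1, h2, hA, hB]

lemma aux_finsetOfX {N m : ℕ} (x : ℕ → ℤ) :
    finsetOfX N (m+1) x = auxSet N (fun k : Fin (m+1) => x (k + 1)) := by
  ext i
  simp only [finsetOfX, auxSet, Finset.mem_filter, Finset.mem_univ, true_and]
  constructor
  · rintro ⟨k, h1, h2, h3⟩
    refine ⟨⟨k - 1, by omega⟩, ?_⟩
    simp only [Nat.sub_add_cancel h1, h3]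
  · rintro ⟨k, hk⟩
    exact ⟨k + 1, by omega, by omega, hk⟩

/-- Entries pairwise distinct modulo `N`. -/
def auxDM {n : ℕ} (N : ℕ) (y : Fin n → ℤ) : Prop :=
  ∀ k l : Fin n, k ≠ l → ¬ ((N : ℤ) ∣ (y k - y l))

lemma auxDM_of_strictMono {n N : ℕ} (y : Fin n → ℤ) (hy : StrictMono y)
    (h1 : ∀ k, 1 ≤ y k ∧ y k ≤ N) : auxDM N y := by
  intro k l hkl hd
  have : y k - y l = 0 := by
    refine Int.eq_zero_of_abs_lt_dvd hd ?_
    have := h1 k; have := h1 l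
    rw [abs_lt]; constructor <;> omega
  exact hkl (hy.injective (by omega))

lemma auxRot_modEq {m N : ℕ} (y : Fin (m+1) → ℤ) (k : Fin (m+1)) :
    ∃ e : ℤ, auxRot N y k = y (finRotate (m+1) k) + N * e := by
  refine Fin.lastCases ?_ (fun j => ?_) k
  · exact ⟨1, by rw [auxRot_last, finRotate_last]; ring⟩
  · exact ⟨0, by rw [auxRot_castSucc, aux_rot_castSucc]; ring⟩

lemma auxDM_rot {m N : ℕ} (y : Fin (m+1) → ℤ) : auxDM N (auxRot N y) ↔ auxDM N y := by
  have key : ∀ k l, (N : ℤ) ∣ auxRot N y k - auxRot N y l ↔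
      (N : ℤ) ∣ y (finRotate (m+1) k) - y (finRotate (m+1) l) := by
    intro k l
    obtain ⟨e, he⟩ := auxRot_modEq (N := N) y k
    obtain ⟨f, hf⟩ := auxRot_modEq (N := N) y l
    rw [he, hf]
    have : y (finRotate (m+1) k) + N * e - (y (finRotate (m+1) l) + N * f)
      = (y (finRotate (m+1) k) - y (finRotate (m+1) l)) + N * (e - f) := by ring
    rw [this, dvd_add_left (dvd_mul_right _ _)]
  constructor
  · intro h k l hkl
    have := h ((finRotate (m+1)).symm k) ((finRotate (m+1)).symm l)
      (fun h => hkl ((finRotate (m+1)).symm.injective h))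
    rw [key] at this
    simpa using this
  · intro h k l hkl
    rw [key]
    exact h _ _ (fun h => hkl ((finRotate (m+1)).injective h))

/-- Interlacing condition for `Rsum`. -/
def auxY {m : ℕ} (N : ℕ) (x : ℕ → ℤ) (y : Fin (m+1) → ℤ) : Prop :=
  (∀ k : Fin (m+1), x (k : ℕ) ≤ y k ∧ y k ≤ x ((k : ℕ) + 1)) ∧ auxDM N y

/-- `y₁ ≤ x₁ ≤ y₂ ≤ …`. -/
def auxI1 {m : ℕ} (a y : Fin (m+1) → ℤ) : Prop :=
  (∀ k, y k ≤ a k) ∧ ∀ j : Fin m, a j.castSucc ≤ y j.succ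

/-- `y ∈ {1, …, N}^n` strictly increasing. -/
def auxT {n : ℕ} (N : ℕ) (y : Fin n → ℤ) : Prop :=
  (∀ k, 1 ≤ y k ∧ y k ≤ N) ∧ StrictMono y

lemma aux_range_mem {m : ℕ} (x : ℕ → ℤ) (hxmono : ∀ i j, i < j → j ≤ m + 1 → x i < x j) (k : ℕ) (hk : k ≤ m) (t : ℤ)
    (h1 : x k ≤ t) (h2 : t ≤ x (k+1)) (ht : k = 0 → t ≠ x k) :
    t ∈ Set.range (fun i : Fin (m+1) => x ((i : ℕ) + 1)) ↔ (t = x k ∨ t = x (k + 1)) := by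
  constructor
  · rintro ⟨j, rfl⟩
    dsimp only at *
    have hj := j.2
    rcases lt_trichotomy ((j:ℕ)+1) k with h | h | h
    · have := hxmono _ _ h (by omega); omega
    · left; rw [h]
    · right
      rcases Nat.lt_or_ge (k+1) ((j:ℕ)+1) with h' | h'
      · have := hxmono _ _ h' (by omega); omega
      · have : (j:ℕ) + 1 = k + 1 := by omega
        rw [this]
  · rintro (h | h)
    · have hk0 : k ≠ 0 := fun h0 => ht h0 h
      refine ⟨⟨k - 1, by omega⟩, ?_⟩
      simp only [h]
      congr 1; omega
    · exact ⟨⟨k, by omega⟩, h.symm⟩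

lemma aux_claim1 {m N : ℕ} (x : ℕ → ℤ) (hx0 : x 0 = x (m+1) - N)
    (hxmono : ∀ i j, i < j → j ≤ m + 1 → x i < x j)
    (hxN : x (m+1) ≤ (N : ℤ))
    (y : Fin (m+1) → ℤ) :
    (auxY N x y ∧ 1 ≤ y 0) ↔
      (auxT N y ∧ auxI1 (fun k : Fin (m+1) => x ((k : ℕ) + 1)) y) := by
  have hle : ∀ i j, i ≤ j → j ≤ m + 1 → x i ≤ x j := by
    intro i j hij hj
    rcases hij.eq_or_lt with rfl | h
    · exact le_rfl
    · exact (hxmono _ _ h hj).le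
  constructor
  · rintro ⟨⟨hY, hD⟩, h0⟩
    have hsm : StrictMono y := by
      rw [Fin.strictMono_iff_lt_succ]
      intro j
      have h1 := (hY j.castSucc).2
      have h2 := (hY j.succ).1
      have h3 : y j.castSucc ≠ y j.succ := by
        intro h
        refine hD j.castSucc j.succ (Fin.castSucc_lt_succ).ne ?_
        rw [h, sub_self]; exact dvd_zero _
      simp only [Fin.val_castSucc, Fin.val_succ] at h1 h2
      omega
    refine ⟨⟨fun k => ⟨?_, ?_⟩, hsm⟩, fun k => (hY k).2, fun j => ?_⟩
    · have := hsm.monotone (Fin.zero_le k); omega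
    · have := (hY k).2
      have := hle (k+1) (m+1) (by omega) le_rfl
      omega
    · have := (hY j.succ).1
      simpa using this
  · rintro ⟨⟨hr, hsm⟩, hI, hI'⟩
    refine ⟨⟨fun k => ⟨?_, hI k⟩, auxDM_of_strictMono y hsm hr⟩, (hr 0).1⟩
    refine Fin.cases ?_ (fun j => ?_) k
    · have := (hr 0).1
      simp only [Fin.val_zero]
      omega
    · have := hI' j
      simpa using this

/-- `x₁ ≤ y₁ ≤ x₂ ≤ …`. -/
def auxI2 {m : ℕ} (a y : Fin (m+1) → ℤ) : Prop :=
  (∀ k, a k ≤ y k) ∧ ∀ j : Fin m, y j.castSucc ≤ a j.succ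

lemma aux_claim2 {m N : ℕ} (x : ℕ → ℤ) (hx0 : x 0 = x (m+1) - N)
    (hxmono : ∀ i j, i < j → j ≤ m + 1 → x i < x j)
    (hx1 : 1 ≤ x 1)
    (hxN : x (m+1) ≤ (N : ℤ))
    (y : Fin (m+1) → ℤ) :
    (auxY N x y ∧ ¬ 1 ≤ y 0) ↔
      (auxT N (auxRot N y) ∧ auxI2 (fun k : Fin (m+1) => x ((k : ℕ) + 1)) (auxRot N y)) := by
  have hle : ∀ i j, i ≤ j → j ≤ m + 1 → x i ≤ x j := by
    intro i j hij hj
    rcases hij.eq_or_lt with rfl | h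
    · exact le_rfl
    · exact (hxmono _ _ h hj).le
  constructor
  · rintro ⟨⟨hY, hD⟩, h0⟩
    have hI : auxI2 (fun k : Fin (m+1) => x ((k : ℕ) + 1)) (auxRot N y) := by
      refine ⟨fun k => ?_, fun j => ?_⟩
      · refine Fin.lastCases ?_ (fun j => ?_) k
        · rw [auxRot_last]
          have := (hY 0).1
          simp only [Fin.val_zero, Fin.val_last] at this ⊢
          omega
        · rw [auxRot_castSucc]
          have := (hY j.succ).1
          simpa using this
      · rw [auxRot_castSucc]
        have := (hY j.succ).2
        simpa using this
    have hD' := auxDM_rot (N := N) y |>.mpr hD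
    have hsm : StrictMono (auxRot N y) := by
      rw [Fin.strictMono_iff_lt_succ]
      intro j
      have h1 := hI.2 j
      have h2 := hI.1 j.succ
      have h3 : auxRot N y j.castSucc ≠ auxRot N y j.succ := by
        intro h
        refine hD' j.castSucc j.succ (Fin.castSucc_lt_succ).ne ?_
        rw [h, sub_self]; exact dvd_zero _
      omega
    refine ⟨⟨fun k => ⟨?_, ?_⟩, hsm⟩, hI⟩
    · have : x ((k:ℕ)+1) ≤ auxRot N y k := hI.1 k
      have := hle 1 (k+1) (by omega) (by omega)
      omega
    · have := hsm.monotone (Fin.le_last k)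
      rw [auxRot_last] at this
      omega
  · rintro ⟨⟨hr, hsm⟩, hI, hI'⟩
    have hlast := hI (Fin.last m)
    have hrlast := hr (Fin.last m)
    rw [auxRot_last] at hlast hrlast
    simp only [Fin.val_last] at hlast
    refine ⟨⟨fun k => ?_, (auxDM_rot y).mp (auxDM_of_strictMono _ hsm hr)⟩, by omega⟩
    refine Fin.cases ?_ (fun j => ?_) k
    · simp only [Fin.val_zero, zero_add]
      omega
    · have h1 := hI j.castSucc
      have h2 := hI' j
      rw [auxRot_castSucc] at h1 h2
      simp only [Fin.val_castSucc, Fin.val_succ] at h1 h2 ⊢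
      exact ⟨h1, h2⟩

/-- The weight in `Rsum`. -/
def auxw {m : ℕ} (c : ℝ) (x : ℕ → ℤ) (y : Fin (m+1) → ℤ) : ℂ :=
  ∏ k : Fin (m+1), if y k = x (k : ℕ) ∨ y k = x ((k : ℕ) + 1) then 1 else (c : ℂ) ^ 2

lemma aux_w1 {m N : ℕ} (x : ℕ → ℤ) (hx0 : x 0 = x (m+1) - N)
    (hxmono : ∀ i j, i < j → j ≤ m + 1 → x i < x j)
    (hxN : x (m+1) ≤ (N : ℤ))
    (c : ℝ) (y : Fin (m+1) → ℤ) (hy : auxY N x y) (h0 : 1 ≤ y 0) :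
    auxw c x y = auxW c (fun k : Fin (m+1) => x ((k : ℕ) + 1)) y := by
  unfold auxw auxW
  refine Finset.prod_congr rfl fun k _ => ?_
  have := aux_range_mem x hxmono k (by omega) (y k) (hy.1 k).1 (hy.1 k).2 (by
    intro hk
    have : k = 0 := by ext; simpa using hk
    subst this
    simp only [Fin.val_zero]
    omega)
  by_cases h : y k = x (k : ℕ) ∨ y k = x ((k : ℕ) + 1)
  · rw [if_pos h, if_pos (this.mpr h)]
  · rw [if_neg h, if_neg (fun h' => h (this.mp h'))]

lemma aux_w2 {m N : ℕ} (x : ℕ → ℤ) (hx0 : x 0 = x (m+1) - N)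
    (hxmono : ∀ i j, i < j → j ≤ m + 1 → x i < x j)
    (hx1 : 1 ≤ x 1)
    (hxN : x (m+1) ≤ (N : ℤ))
    (c : ℝ) (y : Fin (m+1) → ℤ) (hy : auxY N x y) (h0 : ¬ 1 ≤ y 0) :
    auxw c x y = auxW c (fun k : Fin (m+1) => x ((k : ℕ) + 1)) (auxRot N y) := by
  unfold auxw auxW
  rw [Fin.prod_univ_succ, Fin.prod_univ_castSucc, mul_comm]
  simp only [auxRot_castSucc, auxRot_last]
  congr 1
  · refine Finset.prod_congr rfl fun j _ => ?_
    have := aux_range_mem x hxmono (j.succ) (by omega) (y j.succ) (hy.1 j.succ).1 (hy.1 j.succ).2 (by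
      intro hk
      simp at hk)
    simp only [this]
  · have h1 := (hy.1 0).1
    simp only [Fin.val_zero, zero_add] at h1 ⊢
    have : y 0 + N ∈ Set.range (fun i : Fin (m+1) => x ((i : ℕ) + 1)) ↔ (y 0 = x 0 ∨ y 0 = x 1) := by
      constructor
      · rintro ⟨j, hj⟩
        dsimp only at hj
        left
        rcases Nat.lt_or_ge ((j:ℕ)+1) (m+1) with h | h
        · have := hxmono _ _ h le_rfl; omega
        · have h' : (j:ℕ) + 1 = m+1 := by omega
          rw [h'] at hj; omega
      · rintro (h | h)
        · refine ⟨Fin.last m, ?_⟩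
          simp only [Fin.val_last]; omega
        · omega
    simp only [this]


/-- **Corollary 3.4: `(Vψ)(x) = ∑_σ A_σ R_σ`.** -/
theorem Vpsi_eq_sum_Rsum
    (N n : ℕ) (hn : 1 ≤ n) (hnN : 2 * n ≤ N)
    (c : ℝ) (hc : 0 < c) (Δ : ℝ) (hΔ : Δ = (2 - c ^ 2) / 2)
    (Θ : ℝ → ℝ → ℝ)
    (hΘcont : ContinuousOn (fun q : ℝ × ℝ => Θ q.1 q.2) (Ddom Δ ×ˢ Ddom Δ))
    (hΘzero : Θ 0 0 = 0)
    (hΘ : ∀ a ∈ Ddom Δ, ∀ b ∈ Ddom Δ,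
      Complex.exp (-(Complex.I * (Θ a b : ℂ))) =
        Complex.exp (Complex.I * ((a : ℂ) - (b : ℂ))) * Sfun Δ a b / Sfun Δ b a)
    (p : Fin n → ℝ) (hpD : ∀ j, p j ∈ Ddom Δ)
    (hdistinct : Function.Injective p)
    (hBE : ∀ j, Complex.exp (Complex.I * (N : ℂ) * (p j : ℂ)) =
      (-1 : ℂ) ^ (n - 1) *
        Complex.exp (-(Complex.I * ((∑ k, Θ (p j) (p k) : ℝ) : ℂ))))
    (x : ℕ → ℤ) (hx0 : x 0 = x n - N)
    (hxmono : ∀ i j, i < j → j ≤ n → x i < x j)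
    (hx1 : 1 ≤ x 1) (hxN : x n ≤ (N : ℤ))
    :
    (transferV N c).mulVec (psiVec N n Δ p) (finsetOfX N n x) =
      ∑ σ : Equiv.Perm (Fin n), Acoef Δ p σ * Rsum N c x (zOf p) σ := by
  obtain ⟨m, rfl⟩ : ∃ m, n = m + 1 := ⟨n - 1, by omega⟩
  classical
  have hAc := aux_Acoef_rot (N := N) Δ Θ hΘ p hpD hBE
  have hG := auxG_rot Δ p hAc
  set a : Fin (m+1) → ℤ := fun k => x ((k : ℕ) + 1) with ha
  have hle : ∀ i j, i ≤ j → j ≤ m + 1 → x i ≤ x j := by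
    intro i j hij hj
    rcases hij.eq_or_lt with rfl | h
    · exact le_rfl
    · exact (hxmono _ _ h hj).le
  obtain ⟨hA, hAa⟩ : ∃ h : (auxSet N a).card = m + 1, auxB (auxSet N a) h = a := by
    refine auxSet_spec a ?_ ?_
    · intro i j hij
      exact hxmono _ _ (by simpa using hij) (by omega)
    · intro k
      have h1 := hle 1 (k+1) (by omega) (by omega)
      have h2 := hle (k+1) (m+1) (by omega) (by omega)
      simp only [ha]
      exact ⟨by omega, by omega⟩
  rw [aux_finsetOfX]
  change (transferV N c).mulVec (psiVec N (m+1) Δ p) (auxSet N a) = _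
  -- the left-hand side
  have hL : (transferV N c).mulVec (psiVec N (m+1) Δ p) (auxSet N a) =
      ∑ y ∈ (Fintype.piFinset fun _ : Fin (m+1) => Finset.Icc (1:ℤ) N).filter StrictMono,
        ((if auxI1 a y then auxW c a y else 0) + (if auxI2 a y then auxW c a y else 0))
          * auxG Δ p y := by
    change ∑ B, transferV N c (auxSet N a) B * psiVec N (m+1) Δ p B = _
    refine aux_sum_card _ _ ?_ ?_
    · intro B hB
      rw [psiVec, dif_neg hB, mul_zero]
    · intro B hB
      rw [psiVec_eq Δ p B hB, aux_V c _ B hA hB]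
      simp only [hAa]
      exact congrArg₂ _ (congrArg₂ _ (if_congr Iff.rfl rfl rfl) (if_congr Iff.rfl rfl rfl)) rfl
  -- the right-hand side
  have hR : ∑ σ : Equiv.Perm (Fin (m+1)), Acoef Δ p σ * Rsum N c x (zOf p) σ =
      ∑ y ∈ (Fintype.piFinset fun _ : Fin (m+1) => Finset.Icc (x 0) (x (m+1))).filter
        (auxY N x), auxw c x y * auxG Δ p y := by
    simp only [Rsum, Finset.mul_sum, auxG]
    rw [Finset.sum_comm]
    refine Finset.sum_congr ?_ fun y _ => Finset.sum_congr rfl fun σ _ => ?_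
    · ext y; simp only [Finset.mem_filter, auxY, auxDM]
    · have hw : (∏ k : Fin (m+1), if y k = x (k : ℕ) ∨ y k = x ((k : ℕ) + 1) then (1:ℂ)
          else (c : ℂ) ^ 2) = auxw c x y := by
        unfold auxw
        exact Finset.prod_congr rfl fun k _ => by congr
      rw [← hw]
      ring_nf
  have hmemY : ∀ y : Fin (m+1) → ℤ,
      y ∈ (Fintype.piFinset fun _ : Fin (m+1) => Finset.Icc (x 0) (x (m+1))).filter (auxY N x)
        ↔ auxY N x y := by
    intro y
    rw [Finset.mem_filter, Fintype.mem_piFinset, and_iff_right_iff_imp]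
    intro hy k
    have h1 := hle 0 k (by omega) (by omega)
    have h2 := hle (k+1) (m+1) (by omega) le_rfl
    have h3 := hy.1 k
    rw [Finset.mem_Icc]
    constructor <;> omega
  have hmemT : ∀ y : Fin (m+1) → ℤ,
      y ∈ (Fintype.piFinset fun _ : Fin (m+1) => Finset.Icc (1:ℤ) N).filter StrictMono
        ↔ auxT N y := by
    intro y
    rw [Finset.mem_filter, Fintype.mem_piFinset]
    simp only [Finset.mem_Icc, auxT]
  rw [hL, hR]
  simp only [add_mul, Finset.sum_add_distrib, ite_mul, zero_mul, ← Finset.sum_filter]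
  rw [← Finset.sum_filter_add_sum_filter_not
    ((Fintype.piFinset fun _ : Fin (m+1) => Finset.Icc (x 0) (x (m+1))).filter (auxY N x))
    (fun y => 1 ≤ y 0)]
  congr 1
  · refine Finset.sum_congr ?_ ?_
    · ext y
      rw [Finset.mem_filter, hmemT, Finset.mem_filter, hmemY]
      exact (aux_claim1 x hx0 hxmono hxN y).symm
    · intro y hy
      rw [Finset.mem_filter, hmemY] at hy
      rw [aux_w1 x hx0 hxmono hxN c y hy.1 hy.2]
  · symm
    refine Finset.sum_nbij' (auxRot N) (auxUnrot N) ?_ ?_ ?_ ?_ ?_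
    · intro y hy
      rw [Finset.mem_filter, hmemY] at hy
      rw [Finset.mem_filter, hmemT]
      exact (aux_claim2 x hx0 hxmono hx1 hxN y).mp hy
    · intro y hy
      rw [Finset.mem_filter, hmemT] at hy
      rw [Finset.mem_filter, hmemY]
      refine (aux_claim2 x hx0 hxmono hx1 hxN _).mpr ?_
      rw [auxRot_unrot]
      exact hy
    · intro y _; exact auxUnrot_rot N y
    · intro y _; exact auxRot_unrot N y
    · intro y hy
      rw [Finset.mem_filter, hmemY] at hy
      rw [aux_w2 x hx0 hxmono hx1 hxN c y hy.1 hy.2, hG]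
end
end

section
/- Assume p₁,…,pₙ ∈ D_Δ are distinct, all nonzero, and satisfy the Bethe equations, with 1 ≤ n ≤ N/2. Fix 1 ≤ x₁ < … < xₙ ≤ N, x₀ = xₙ − N. Then (Vψ)(x) = Σ_{w ∈ 𝒲₀} Σ_{σ∈S_n} A_σ r_σ(w) Z_σ(w), where 𝒲₀ = {L⋯L, M⋯M} is the set of the two constant words; moreover the M⋯M contribution equals (Π_{i=1}^n M(z_i)) ψ(x) and the L⋯L contribution equals (Π_{i=1}^n L(z_i)) ψ(x). -/
open scoped BigOperators
open Complex

noncomputable section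

/-- `Z_σ(w)`; the letter `L` is encoded by `true` and the letter `M` by `false`. -/
def Zword {n : ℕ} (x : ℕ → ℤ) (z : Fin n → ℂ) (σ : Equiv.Perm (Fin n))
    (w : Fin n → Bool) : ℂ :=
  ∏ k : Fin n, if w k then z (σ k) ^ (x (k : ℕ)) else z (σ k) ^ (x ((k : ℕ) + 1))

/-- `r_σ(w)`; the letter `L` is encoded by `true` and the letter `M` by `false`;
cyclic successor and predecessor of indices are given by `finRotate`. -/
def rword {n : ℕ} (c : ℝ) (z : Fin n → ℂ) (σ : Equiv.Perm (Fin n))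
    (w : Fin n → Bool) : ℂ :=
  (∏ k : Fin n, if w k = false ∧ w (finRotate n k) = true then
      Mfun c (z (σ k)) * Lfun c (z (σ (finRotate n k))) - 1 else 1) *
  (∏ k : Fin n, if w ((finRotate n).symm k) = true ∧ w k = true then
      Lfun c (z (σ k)) else 1) *
  (∏ k : Fin n, if w k = false ∧ w (finRotate n k) = false then
      Mfun c (z (σ k)) else 1)

namespace VpsiAux

theorem pairProd_succ {m : ℕ} (f : Fin (m+1) → Fin (m+1) → ℂ) :
    ∏ kl ∈ Finset.univ.filter (fun kl : Fin (m+1) × Fin (m+1) => kl.1 < kl.2), f kl.1 kl.2 =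
    (∏ l : Fin m, f 0 l.succ) *
    ∏ kl ∈ Finset.univ.filter (fun kl : Fin m × Fin m => kl.1 < kl.2), f kl.1.succ kl.2.succ := by
  simp only [Finset.prod_filter, Fintype.prod_prod_type]
  rw [Fin.prod_univ_succ]
  congr 1
  · rw [Fin.prod_univ_succ]; simp
  · refine Finset.prod_congr rfl fun k _ => ?_
    rw [Fin.prod_univ_succ]; simp

theorem pairProd_last {m : ℕ} (f : Fin (m+1) → Fin (m+1) → ℂ) :
    ∏ kl ∈ Finset.univ.filter (fun kl : Fin (m+1) × Fin (m+1) => kl.1 < kl.2), f kl.1 kl.2 =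
    (∏ l : Fin m, f l.castSucc (Fin.last m)) *
    ∏ kl ∈ Finset.univ.filter (fun kl : Fin m × Fin m => kl.1 < kl.2),
      f kl.1.castSucc kl.2.castSucc := by
  simp only [Finset.prod_filter, Fintype.prod_prod_type]
  rw [Fin.prod_univ_castSucc]
  have h1 : ∏ l : Fin (m+1), (if Fin.last m < l then f (Fin.last m) l else 1) = 1 := by
    refine Finset.prod_eq_one fun l _ => ?_
    rw [if_neg]; exact not_lt.mpr (Fin.le_last l)
  rw [h1, mul_one, ← Finset.prod_mul_distrib]
  refine Finset.prod_congr rfl fun k _ => ?_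
  rw [Fin.prod_univ_castSucc, mul_comm]
  simp [Fin.castSucc_lt_last]

/-- swapping two neighbours. -/
theorem pairProd_swap {n : ℕ} (f : Fin n → Fin n → ℂ) (u v : Fin n) (huv : (u : ℕ) + 1 = v) :
    (∏ kl ∈ Finset.univ.filter (fun kl : Fin n × Fin n => kl.1 < kl.2),
      f (Equiv.swap u v kl.1) (Equiv.swap u v kl.2)) * f u v =
    (∏ kl ∈ Finset.univ.filter (fun kl : Fin n × Fin n => kl.1 < kl.2), f kl.1 kl.2) * f v u := by
  have hmem : (u, v) ∈ Finset.univ.filter (fun kl : Fin n × Fin n => kl.1 < kl.2) := by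
    simp only [Finset.mem_filter, Finset.mem_univ, true_and, Fin.lt_def]; omega
  rw [← Finset.mul_prod_erase _ _ hmem, ← Finset.mul_prod_erase _ _ hmem]
  simp only [Equiv.swap_apply_left, Equiv.swap_apply_right]
  have : ∏ kl ∈ (Finset.univ.filter (fun kl : Fin n × Fin n => kl.1 < kl.2)).erase (u, v),
      f (Equiv.swap u v kl.1) (Equiv.swap u v kl.2) =
      ∏ kl ∈ (Finset.univ.filter (fun kl : Fin n × Fin n => kl.1 < kl.2)).erase (u, v),
      f kl.1 kl.2 := by
    refine Finset.prod_equiv (Equiv.prodCongr (Equiv.swap u v) (Equiv.swap u v)) ?_ ?_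
    · rintro ⟨k, l⟩
      simp only [Finset.mem_erase, Finset.mem_filter, Finset.mem_univ, true_and,
        Equiv.prodCongr_apply, Prod.map, ne_eq, Prod.mk.injEq, Equiv.swap_apply_def, Fin.lt_def,
        Fin.ext_iff]
      split_ifs <;> omega
    · intro _ _; rfl
  rw [this]; ring

theorem Acoef_swap {n : ℕ} (Δ : ℝ) (p : Fin n → ℝ) (σ : Equiv.Perm (Fin n)) (u v : Fin n)
    (huv : (u : ℕ) + 1 = v) :
    Acoef Δ p (σ * Equiv.swap u v) *
      (Complex.exp (Complex.I * (p (σ u) : ℂ)) * Sfun Δ (p (σ u)) (p (σ v))) =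
    - (Acoef Δ p σ *
      (Complex.exp (Complex.I * (p (σ v) : ℂ)) * Sfun Δ (p (σ v)) (p (σ u)))) := by
  have hne : u ≠ v := by intro h; rw [h] at huv; omega
  have := pairProd_swap (fun i j => Complex.exp (Complex.I * (p (σ i) : ℂ)) *
    Sfun Δ (p (σ i)) (p (σ j))) u v huv
  unfold Acoef
  rw [Equiv.Perm.sign_mul, Equiv.Perm.sign_swap hne]
  simp only [Equiv.Perm.coe_mul, Function.comp_apply]
  rw [mul_assoc, this]
  push_cast
  ring

theorem bethe_prod {m : ℕ} {N : ℕ} {Δ : ℝ} {Θ : ℝ → ℝ → ℝ}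
    (hΘ : ∀ a ∈ Ddom Δ, ∀ b ∈ Ddom Δ,
      Complex.exp (-(Complex.I * (Θ a b : ℂ))) =
        Complex.exp (Complex.I * ((a : ℂ) - (b : ℂ))) * Sfun Δ a b / Sfun Δ b a)
    (p : Fin (m+1) → ℝ) (hpD : ∀ j, p j ∈ Ddom Δ)
    (hBE : ∀ j, Complex.exp (Complex.I * (N : ℂ) * (p j : ℂ)) =
      (-1 : ℂ) ^ (m+1 - 1) *
        Complex.exp (-(Complex.I * ((∑ k, Θ (p j) (p k) : ℝ) : ℂ)))) 
    (σ : Equiv.Perm (Fin (m+1))) :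
    zOf p (σ 0) ^ N * ∏ l : Fin m, Complex.exp (Complex.I * (p (σ l.succ) : ℂ)) *
        Sfun Δ (p (σ l.succ)) (p (σ 0)) =
      (-1) ^ m * ∏ l : Fin m, Complex.exp (Complex.I * (p (σ 0) : ℂ)) *
        Sfun Δ (p (σ 0)) (p (σ l.succ)) := by
  have hS : ∀ i j, Sfun Δ (p i) (p j) ≠ 0 := by
    intro i j h
    have := hΘ _ (hpD j) _ (hpD i)
    rw [h, div_zero] at this
    exact Complex.exp_ne_zero _ this
  have h1 : zOf p (σ 0) ^ N = (-1) ^ m * ∏ l : Fin m,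
      Complex.exp (Complex.I * ((p (σ 0) : ℂ) - (p (σ l.succ) : ℂ))) * Sfun Δ (p (σ 0)) (p (σ l.succ)) / Sfun Δ (p (σ l.succ)) (p (σ 0)) := by
    have h2 := hBE (σ 0)
    have h3 : zOf p (σ 0) ^ N = Complex.exp (Complex.I * (N : ℂ) * (p (σ 0) : ℂ)) := by
      rw [zOf, ← Complex.exp_nat_mul]; congr 1; ring
    rw [h3, h2, Nat.add_sub_cancel]
    congr 1
    push_cast
    rw [Finset.mul_sum, ← Finset.sum_neg_distrib, Complex.exp_sum, ← Equiv.prod_comp σ,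
      Fin.prod_univ_succ, hΘ _ (hpD _) _ (hpD _)]
    rw [sub_self, mul_zero, Complex.exp_zero, one_mul, div_self (hS _ _), one_mul]
    exact Finset.prod_congr rfl fun l _ => hΘ _ (hpD _) _ (hpD _)
  rw [h1, mul_assoc, ← Finset.prod_mul_distrib]
  congr 1
  refine Finset.prod_congr rfl fun l _ => ?_
  rw [mul_sub, Complex.exp_sub]
  have := hS (σ l.succ) (σ 0)
  have := Complex.exp_ne_zero (Complex.I * (p (σ l.succ) : ℂ))
  field_simp

theorem Acoef_rot {m : ℕ} {N : ℕ} {Δ : ℝ} {Θ : ℝ → ℝ → ℝ}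
    (hΘ : ∀ a ∈ Ddom Δ, ∀ b ∈ Ddom Δ,
      Complex.exp (-(Complex.I * (Θ a b : ℂ))) =
        Complex.exp (Complex.I * ((a : ℂ) - (b : ℂ))) * Sfun Δ a b / Sfun Δ b a)
    (p : Fin (m+1) → ℝ) (hpD : ∀ j, p j ∈ Ddom Δ)
    (hBE : ∀ j, Complex.exp (Complex.I * (N : ℂ) * (p j : ℂ)) =
      (-1 : ℂ) ^ (m+1 - 1) *
        Complex.exp (-(Complex.I * ((∑ k, Θ (p j) (p k) : ℝ) : ℂ)))) 
    (σ : Equiv.Perm (Fin (m+1))) :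
    Acoef Δ p (σ * finRotate (m+1)) * zOf p (σ 0) ^ N = Acoef Δ p σ := by
  have hb := bethe_prod hΘ p hpD hBE σ
  have hp1 := pairProd_succ (fun i j => Complex.exp (Complex.I * (p (σ i) : ℂ)) *
    Sfun Δ (p (σ i)) (p (σ j)))
  have hp2 := pairProd_last (fun i j => Complex.exp (Complex.I * (p ((σ * finRotate (m+1)) i) : ℂ)) *
    Sfun Δ (p ((σ * finRotate (m+1)) i)) (p ((σ * finRotate (m+1)) j)))
  unfold Acoef
  rw [hp1, hp2]
  have hc : ∀ k : Fin m, finRotate (m+1) k.castSucc = k.succ := by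
    intro k; rw [finRotate_apply]; simp
  rw [Equiv.Perm.sign_mul, sign_finRotate]
  simp only [Equiv.Perm.coe_mul, Function.comp_apply, hc, finRotate_last]
  push_cast
  have h1 : ((-1:ℂ)^m) * (-1)^m = 1 := by rw [← mul_pow]; simp
  generalize (∏ l : Fin m, Complex.exp (Complex.I * (p (σ l.succ) : ℂ)) *
        Sfun Δ (p (σ l.succ)) (p (σ 0))) = P1 at *
  generalize (∏ l : Fin m, Complex.exp (Complex.I * (p (σ 0) : ℂ)) *
        Sfun Δ (p (σ 0)) (p (σ l.succ))) = P2 at *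
  generalize zOf p (σ 0) ^ N = Z at *
  generalize ((Equiv.Perm.sign σ : ℤ) : ℂ) = e at *
  generalize (∏ kl ∈ Finset.univ.filter (fun kl : Fin m × Fin m => kl.1 < kl.2),
    (Complex.exp (Complex.I * (p (σ kl.1.succ) : ℂ)) *
      Sfun Δ (p (σ kl.1.succ)) (p (σ kl.2.succ)))) = Q at *
  linear_combination e * (-1)^m * Q * hb + e * P2 * Q * h1

def psiT {n : ℕ} (Δ : ℝ) (p : Fin n → ℝ) (y : Fin n → ℤ) : ℂ :=
  ∑ σ : Equiv.Perm (Fin n), Acoef Δ p σ * ∏ k : Fin n, zOf p (σ k) ^ (y k)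

theorem zOf_ne_zero {n : ℕ} (p : Fin n → ℝ) (j : Fin n) : zOf p j ≠ 0 := Complex.exp_ne_zero _

theorem psiT_rot {m : ℕ} {N : ℕ} {Δ : ℝ} (p : Fin (m+1) → ℝ)
    (hA : ∀ σ, Acoef Δ p (σ * finRotate (m+1)) * zOf p (σ 0) ^ N = Acoef Δ p σ)
    (y y' : Fin (m+1) → ℤ) (hy : ∀ k : Fin m, y' k.castSucc = y k.succ)
    (hl : y' (Fin.last m) = y 0 + N) :
    psiT Δ p y' = psiT Δ p y := by
  unfold psiT
  rw [← Equiv.sum_comp (Equiv.mulRight (finRotate (m+1)))]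
  refine Finset.sum_congr rfl fun σ _ => ?_
  have hc : ∀ k : Fin m, finRotate (m+1) k.castSucc = k.succ := by
    intro k; rw [finRotate_apply]; simp
  rw [Fin.prod_univ_castSucc, Fin.prod_univ_succ]
  simp only [Equiv.coe_mulRight, Equiv.Perm.coe_mul, Function.comp_apply, hc, finRotate_last, hy, hl]
  rw [← hA σ, zpow_add₀ (zOf_ne_zero _ _), zpow_natCast]
  ring

theorem gen_sum {n : ℕ} {Y : Type*} (I : Fin n → Finset Y) (F a b : Fin n → Y → ℂ)
    (hab : ∀ k, ∀ y ∈ I k, a k y * b k y = 0) :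
    ∑ y ∈ Fintype.piFinset I, (∏ k, F k (y k)) *
      ∏ k, (1 - b k (y k) * a (finRotate n k) (y (finRotate n k))) =
    ∑ S : Finset (Fin n), (-1) ^ S.card * ∏ k, 
      if k ∈ S then (if (finRotate n).symm k ∈ S then 0 else ∑ y ∈ I k, F k y * b k y)
      else (if (finRotate n).symm k ∈ S then ∑ y ∈ I k, F k y * a k y else ∑ y ∈ I k, F k y) := by
  have key : ∀ S : Finset (Fin n), (∏ k, 
      if k ∈ S then (if (finRotate n).symm k ∈ S then 0 else ∑ y ∈ I k, F k y * b k y)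
      else (if (finRotate n).symm k ∈ S then ∑ y ∈ I k, F k y * a k y else ∑ y ∈ I k, F k y)) =
      ∑ y ∈ Fintype.piFinset I, (∏ k, F k (y k)) *
        ∏ k ∈ S, (b k (y k) * a (finRotate n k) (y (finRotate n k))) := by
    intro S
    have h1 : ∀ k, (if k ∈ S then (if (finRotate n).symm k ∈ S then 0 else ∑ y ∈ I k, F k y * b k y)
      else (if (finRotate n).symm k ∈ S then ∑ y ∈ I k, F k y * a k y else ∑ y ∈ I k, F k y)) =
      ∑ y ∈ I k, F k y * ((if k ∈ S then b k y else 1) *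
        (if (finRotate n).symm k ∈ S then a k y else 1)) := by
      intro k
      split_ifs
      · symm
        refine Finset.sum_eq_zero fun y hy => ?_
        rw [mul_comm (b k y), hab k y hy, mul_zero]
      · simp
      · simp
      · simp
    simp only [h1]
    rw [Finset.prod_univ_sum]
    refine Finset.sum_congr rfl fun y _ => ?_
    rw [Finset.prod_mul_distrib, Finset.prod_mul_distrib, Finset.prod_mul_distrib]
    congr 2
    · simp
    · rw [← Equiv.prod_comp (finRotate n)]; simp only [Equiv.symm_apply_apply]; simp
  simp only [key, Finset.mul_sum]
  rw [Finset.sum_comm]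
  refine Finset.sum_congr rfl fun y _ => ?_
  simp only [sub_eq_add_neg]
  rw [Finset.prod_one_add, Finset.mul_sum, Finset.powerset_univ]
  refine Finset.sum_congr rfl fun S _ => ?_
  rw [Finset.prod_neg]
  ring

theorem geo_sum (z : ℂ) (hz : z ≠ 1) (hz0 : z ≠ 0) (c : ℝ) (u : ℤ) (d : ℕ) :
    ∑ y ∈ Finset.Icc u (u + d + 1), (if y = u ∨ y = u + d + 1 then (1:ℂ) else (c:ℂ)^2) * z ^ y =
    Lfun c z * z ^ u + Mfun c z * z ^ (u + d + 1) := by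
  have h1 : (1 : ℂ) - z ≠ 0 := sub_ne_zero.mpr (Ne.symm hz)
  have e : Finset.Icc u (u + d + 1) = insert u (insert (u+d+1) (Finset.Ioo u (u+d+1))) := by
    ext y; simp only [Finset.mem_Icc, Finset.mem_insert, Finset.mem_Ioo]; omega
  have hg : ∀ d : ℕ, ∑ y ∈ Finset.Ioo u (u+d+1), z ^ y = (z ^ (u+1) - z^(u+d+1)) / (1 - z) := by
    intro d
    induction d with
    | zero => 
      have : Finset.Ioo u (u+(0:ℕ)+1) = ∅ := by ext y; simp
      rw [this]; simp
    | succ d ih =>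
      have : Finset.Ioo u (u+(d+1:ℕ)+1) = insert (u+d+1) (Finset.Ioo u (u+d+1)) := by
        ext y; simp only [Finset.mem_insert, Finset.mem_Ioo]; push_cast; omega
      rw [this, Finset.sum_insert (by simp), ih]
      have : z ^ (u + (d+1:ℕ) + 1) = z ^ (u+d+1) * z := by
        rw [← zpow_add_one₀ hz0]; push_cast; ring_nf
      rw [this]; field_simp; ring
  rw [e, Finset.sum_insert (by simp only [Finset.mem_insert, Finset.mem_Ioo]; omega), Finset.sum_insert (by simp)]
  have : ∑ y ∈ Finset.Ioo u (u+d+1), (if y = u ∨ y = u + d + 1 then (1:ℂ) else (c:ℂ)^2) * z ^ y =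
      (c:ℂ)^2 * ∑ y ∈ Finset.Ioo u (u+d+1), z ^ y := by
    rw [Finset.mul_sum]
    refine Finset.sum_congr rfl fun y hy => ?_
    rw [Finset.mem_Ioo] at hy
    rw [if_neg (by omega)]
  rw [this, hg, Lfun, Mfun, zpow_add_one₀ hz0 u]
  simp
  field_simp
  ring

theorem ML_eq (c : ℝ) (Δ : ℝ) (hΔ : Δ = (2 - c ^ 2) / 2) {n : ℕ} (p : Fin n → ℝ)
    (i j : Fin n) (hi : zOf p i ≠ 1) (hj : zOf p j ≠ 1) :
    Mfun c (zOf p i) * Lfun c (zOf p j) - 1 =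
      (-(c:ℂ)^2 / ((1 - zOf p i) * (1 - zOf p j))) *
        (Complex.exp (Complex.I * (p j : ℂ)) * Sfun Δ (p j) (p i)) := by
  have h1 : (1 : ℂ) - zOf p i ≠ 0 := sub_ne_zero.mpr (Ne.symm hi)
  have h2 : (1 : ℂ) - zOf p j ≠ 0 := sub_ne_zero.mpr (Ne.symm hj)
  have h0 := zOf_ne_zero p j
  have e : Complex.exp (Complex.I * (p j : ℂ)) * Sfun Δ (p j) (p i) =
    1 + zOf p j * zOf p i - (2 - c^2) * zOf p j := by
    unfold Sfun
    rw [Complex.exp_neg]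
    change zOf p j * ((zOf p j)⁻¹ + zOf p i - _) = _
    rw [hΔ]; push_cast; field_simp
  rw [e, Mfun, Lfun]
  field_simp
  ring

theorem z_not_real {Δ : ℝ} {n : ℕ} (p : Fin n → ℝ) (hpD : ∀ j, p j ∈ Ddom Δ)
    (hnonzero : ∀ j, p j ≠ 0) (j : Fin n) (w : ℝ) : zOf p j ≠ (w:ℂ) := by
  intro h
  have hmu : 0 ≤ muD Δ := by
    unfold muD; split_ifs
    · exact Real.arccos_nonneg _
    · exact le_rfl
  obtain ⟨h1, h2⟩ := hpD j
  rw [zOf, mul_comm] at h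
  have := congrArg Complex.im h
  rw [Complex.exp_ofReal_mul_I_im, Complex.ofReal_im] at this
  exact hnonzero j ((Real.sin_eq_zero_iff_of_lt_of_lt (by linarith) (by linarith)).1 this)

theorem M_ne (c : ℝ) {n : ℕ} (p : Fin n → ℝ) (j : Fin n)
    (hr : ∀ w : ℝ, zOf p j ≠ (w:ℂ)) : Mfun c (zOf p j) ≠ 0 := by
  have h1 : (1 : ℂ) - zOf p j ≠ 0 := sub_ne_zero.mpr (Ne.symm (by simpa using hr 1))
  intro h
  rw [Mfun] at h
  field_simp at h
  apply hr (1 - c^2)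
  push_cast
  linear_combination -h

theorem L_ne (c : ℝ) {n : ℕ} (p : Fin n → ℝ) (j : Fin n)
    (hr : ∀ w : ℝ, zOf p j ≠ (w:ℂ)) : Lfun c (zOf p j) ≠ 0 := by
  have h1 : (1 : ℂ) - zOf p j ≠ 0 := sub_ne_zero.mpr (Ne.symm (by simpa using hr 1))
  intro h
  rw [Lfun] at h
  field_simp at h
  have h2 : zOf p j * (1 - c^2 : ℂ) = 1 := by linear_combination -h
  have h3 : (1 - c^2 : ℂ) ≠ 0 := by intro h4; rw [h4] at h2; simp at h2
  apply hr (1 / (1 - c^2))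
  push_cast
  rw [eq_div_iff h3]; exact h2

theorem word_rZ {m : ℕ} (c : ℝ) (z : Fin (m+1) → ℂ) (hM : ∀ j, Mfun c (z j) ≠ 0)
    (hL : ∀ j, Lfun c (z j) ≠ 0) (x : ℕ → ℤ)
    (σ : Equiv.Perm (Fin (m+1))) (w : Fin (m+1) → Bool) :
    (∏ k, (if w k then Lfun c (z (σ k)) * z (σ k) ^ (x (k:ℕ)) else
        Mfun c (z (σ k)) * z (σ k) ^ (x ((k:ℕ)+1)))) *
      ∏ k, (1 - (if w k then 0 else (Mfun c (z (σ k)))⁻¹) *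
        (if w (finRotate (m+1) k) then (Lfun c (z (σ (finRotate (m+1) k))))⁻¹ else 0)) =
    rword c z σ w * Zword x z σ w := by
  have h1 : (∏ k, (if w k then Lfun c (z (σ k)) * z (σ k) ^ (x (k:ℕ)) else
        Mfun c (z (σ k)) * z (σ k) ^ (x ((k:ℕ)+1)))) =
      ((∏ k, (if w k then 1 else Mfun c (z (σ k)))) *
       ∏ k, (if w (finRotate (m+1) k) then Lfun c (z (σ (finRotate (m+1) k))) else 1)) *
       Zword x z σ w := by
    rw [Equiv.prod_comp (finRotate (m+1)) (fun k => if w k then Lfun c (z (σ k)) else 1)]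
    rw [Zword, ← Finset.prod_mul_distrib, ← Finset.prod_mul_distrib]
    refine Finset.prod_congr rfl fun k _ => ?_
    split_ifs <;> simp
  have h2 : (∏ k : Fin (m+1), if w ((finRotate (m+1)).symm k) = true ∧ w k = true then
      Lfun c (z (σ k)) else 1) = ∏ k, if w k = true ∧ w (finRotate (m+1) k) = true then
      Lfun c (z (σ (finRotate (m+1) k))) else 1 := by
    rw [← Equiv.prod_comp (finRotate (m+1))]
    simp only [Equiv.symm_apply_apply]
  rw [h1, rword, h2, mul_right_comm]
  congr 1
  simp only [← Finset.prod_mul_distrib]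
  refine Finset.prod_congr rfl fun k _ => ?_
  have h3 := hM (σ k)
  have h4 := hL (σ (finRotate (m+1) k))
  clear h1 h2
  generalize finRotate (m+1) k = q at *
  cases w k <;> cases w q <;> simp
  field_simp

theorem word_sum {m : ℕ} (c : ℝ) (z : Fin (m+1) → ℂ) (hM : ∀ j, Mfun c (z j) ≠ 0)
    (hL : ∀ j, Lfun c (z j) ≠ 0) (hz1 : ∀ j, z j ≠ 1) (hz0 : ∀ j, z j ≠ 0) (x : ℕ → ℤ)
    (hx : ∀ k : Fin (m+1), x k < x (k+1))
    (σ : Equiv.Perm (Fin (m+1))) :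
    ∑ y ∈ Fintype.piFinset (fun k : Fin (m+1) => Finset.Icc (x k) (x (k+1))),
      (∏ k, (if y k = x k ∨ y k = x (k+1) then (1:ℂ) else (c:ℂ)^2) * z (σ k) ^ (y k)) *
      (∏ k : Fin (m+1), (1 - (if y k = x (k+1) then (1:ℂ) else 0) *
        (if y (finRotate (m+1) k) = x (finRotate (m+1) k : Fin (m+1)) then (1:ℂ) else 0))) =
    ∑ w : Fin (m+1) → Bool, rword c z σ w * Zword x z σ w := by
  rw [gen_sum (fun k : Fin (m+1) => Finset.Icc (x k) (x (k+1)))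
    (fun k y => (if y = x k ∨ y = x (k+1) then (1:ℂ) else (c:ℂ)^2) * z (σ k) ^ y)
    (fun k y => if y = x k then (1:ℂ) else 0) (fun k y => if y = x (k+1) then (1:ℂ) else 0)]
  · simp only [← word_rZ c z hM hL x σ]
    have := gen_sum (fun k : Fin (m+1) => (Finset.univ : Finset Bool))
      (fun k b => if b then Lfun c (z (σ k)) * z (σ k) ^ (x (k:ℕ)) else
        Mfun c (z (σ k)) * z (σ k) ^ (x ((k:ℕ)+1)))
      (fun k b => if b then (Lfun c (z (σ k)))⁻¹ else 0)
      (fun k b => if b then 0 else (Mfun c (z (σ k)))⁻¹) (by intro k y _; cases y <;> simp)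
    rw [Fintype.piFinset_univ] at this
    rw [this]
    refine Finset.sum_congr rfl fun S _ => ?_
    congr 1
    refine Finset.prod_congr rfl fun k _ => ?_
    have h1 := hx k
    have hMk := hM (σ k)
    have hLk := hL (σ k)
    congr 1
    · congr 1
      have e : ∀ y : ℤ, (if y = x k ∨ y = x (k+1) then (1:ℂ) else (c:ℂ)^2) * z (σ k) ^ y * (if y = x (k+1) then (1:ℂ) else 0) = if y = x (k+1) then z (σ k) ^ y else 0 := by
        intro y; split_ifs <;> simp_all
      simp only [e, Finset.sum_ite_eq', Fintype.sum_bool]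
      rw [if_pos (by rw [Finset.mem_Icc]; omega)]
      simp
      field_simp
    · congr 1
      · have e : ∀ y : ℤ, (if y = x k ∨ y = x (k+1) then (1:ℂ) else (c:ℂ)^2) * z (σ k) ^ y * (if y = x k then (1:ℂ) else 0) = if y = x k then z (σ k) ^ y else 0 := by
          intro y; split_ifs <;> simp_all
        simp only [e, Finset.sum_ite_eq', Fintype.sum_bool]
        rw [if_pos (by rw [Finset.mem_Icc]; omega)]
        simp
        field_simp
      · obtain ⟨d, hd⟩ : ∃ d : ℕ, x (k+1) = x k + d + 1 := ⟨(x (k+1) - x k - 1).toNat, by omega⟩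
        have := geo_sum (z (σ k)) (hz1 _) (hz0 _) c (x k) d
        rw [← hd] at this
        rw [this]; simp
  · intro k y _
    have := hx k
    split_ifs
    · omega
    all_goals simp

theorem vanish {m : ℕ} {N : ℕ} {Δ : ℝ} (c : ℝ) (hΔ : Δ = (2 - c ^ 2) / 2) (p : Fin (m+1) → ℝ)
    (hA : ∀ σ, Acoef Δ p (σ * finRotate (m+1)) * zOf p (σ 0) ^ N = Acoef Δ p σ)
    (hz1 : ∀ j, zOf p j ≠ 1) (x : ℕ → ℤ) (hx0 : x 0 = x (m+1) - N)
    (w : Fin (m+1) → Bool) (k : Fin (m+1)) (hk : w k = false) 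
    (hk' : w (finRotate (m+1) k) = true) :
    ∑ σ : Equiv.Perm (Fin (m+1)), Acoef Δ p σ * (rword c (zOf p) σ w * Zword x (zOf p) σ w) = 0 := by
  set l := finRotate (m+1) k with hl
  have hkl : k ≠ l := by intro h; rw [← h, hk] at hk'; simp at hk'
  have hlr : ∀ j, finRotate (m+1) j = l → j = k := fun j hj => (finRotate (m+1)).injective hj
  -- split off the factors of k and l
  have hr : ∃ R : (Fin (m+1) → Fin (m+1)) → ℂ, (∀ f g, (∀ j, j ≠ k → j ≠ l → f j = g j) → R f = R g) ∧
      ∀ σ : Equiv.Perm (Fin (m+1)), rword c (zOf p) σ w * Zword x (zOf p) σ w =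
        (Mfun c (zOf p (σ k)) * Lfun c (zOf p (σ l)) - 1) *
        (zOf p (σ k) ^ x (k+1) * zOf p (σ l) ^ x l) * R σ := by
    refine ⟨fun f => ((∏ j ∈ Finset.univ.erase k, if w j = false ∧ w (finRotate (m+1) j) = true then
      Mfun c (zOf p (f j)) * Lfun c (zOf p (f (finRotate (m+1) j))) - 1 else 1) *
      (∏ j, if w ((finRotate (m+1)).symm j) = true ∧ w j = true then
        Lfun c (zOf p (f j)) else 1) *
      (∏ j, if w j = false ∧ w (finRotate (m+1) j) = false then
        Mfun c (zOf p (f j)) else 1)) * ∏ j ∈ (Finset.univ.erase k).erase l,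
        if w j then zOf p (f j) ^ (x (j : ℕ)) else zOf p (f j) ^ (x ((j : ℕ) + 1)), ?_, ?_⟩
    · intro f g hfg
      have hs : (finRotate (m+1)).symm l = k := by rw [hl, Equiv.symm_apply_apply]
      beta_reduce
      congr 1
      · congr 1
        · congr 1
          · refine Finset.prod_congr rfl fun j hj => ?_
            rw [Finset.mem_erase] at hj
            split_ifs with h
            · rw [hfg j hj.1 (by rintro rfl; simp [hk'] at h), 
                hfg (finRotate (m+1) j) (by intro h2; simp [h2, hk] at h)
                  (fun h2 => hj.1 (hlr j h2))]
            · rfl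
          · refine Finset.prod_congr rfl fun j _ => ?_
            split_ifs with h
            · rw [hfg j (by rintro rfl; simp [hk] at h) (by rintro rfl; simp [hs, hk] at h)]
            · rfl
        · refine Finset.prod_congr rfl fun j _ => ?_
          split_ifs with h
          · rw [hfg j (by rintro rfl; rw [← hl] at h; simp [hk'] at h) (by rintro rfl; simp [hk'] at h)]
          · rfl
      · refine Finset.prod_congr rfl fun j hj => ?_
        simp only [Finset.mem_erase] at hj
        rw [hfg j hj.2.1 hj.1]
    · intro σ
      rw [rword, Zword, ← Finset.mul_prod_erase Finset.univ (fun j => if w j = false ∧ w (finRotate (m+1) j) = true then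
      Mfun c (zOf p (σ j)) * Lfun c (zOf p (σ (finRotate (m+1) j))) - 1 else 1) (Finset.mem_univ k),
      ← Finset.mul_prod_erase Finset.univ (fun j => if w j then zOf p (σ j) ^ (x (j : ℕ)) else zOf p (σ j) ^ (x ((j : ℕ) + 1))) (Finset.mem_univ k),
      ← Finset.mul_prod_erase (Finset.univ.erase k) (fun j => if w j then zOf p (σ j) ^ (x (j : ℕ)) else zOf p (σ j) ^ (x ((j : ℕ) + 1))) (show l ∈ Finset.univ.erase k by simp [hkl.symm])]
      simp only [← hl, hk, hk', and_self, if_true, Bool.false_eq_true, if_false]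
      ring
  obtain ⟨R, hR, hrZ⟩ := hr
  -- the pair identity
  have hpair : ∀ σ : Equiv.Perm (Fin (m+1)), 
      Acoef Δ p σ * zOf p (σ l) ^ (x l - x (k+1)) * (Complex.exp (Complex.I * (p (σ l) : ℂ)) * Sfun Δ (p (σ l)) (p (σ k))) +
      Acoef Δ p (σ * Equiv.swap k l) * zOf p (σ k) ^ (x l - x (k+1)) * (Complex.exp (Complex.I * (p (σ k) : ℂ)) * Sfun Δ (p (σ k)) (p (σ l))) = 0 := by
    intro σ
    by_cases hlast : k = Fin.last m
    · have hl0 : l = 0 := by rw [hl, hlast, finRotate_last]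
      have hm : 0 < m := by
        rcases Nat.eq_zero_or_pos m with h | h
        · subst h; exact absurd (Fin.ext (by omega)) hkl
        · exact h
      have e : x l - x (k+1) = -(N:ℤ) := by rw [hl0, hlast]; simp [hx0]
      have hAi : ∀ τ, Acoef Δ p τ * zOf p (τ 0) ^ (-(N:ℤ)) = Acoef Δ p (τ * finRotate (m+1)) := by
        intro τ
        rw [← hA τ, zpow_neg, zpow_natCast]
        have := zOf_ne_zero p (τ 0)
        field_simp
      have hA1 := hAi σ
      have hA2 := hAi (σ * Equiv.swap k l)
      set u : Fin (m+1) := ⟨m-1, by omega⟩ with hu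
      have hru : finRotate (m+1) u = k := by
        rw [hlast, hu, finRotate_of_lt (by omega)]
        ext; simp; omega
      have hsw : Equiv.swap k l * finRotate (m+1) = finRotate (m+1) * Equiv.swap u k := by
        rw [← hru, hl, ← hru]
        rw [Equiv.mul_swap_eq_swap_mul]
      have hA3 := Acoef_swap Δ p (σ * finRotate (m+1)) u k (by rw [hlast]; simp [hu]; omega)
      rw [mul_assoc σ, hsw, ← mul_assoc] at hA2
      rw [← hA2, ← hA1] at hA3
      simp only [Equiv.Perm.coe_mul, Function.comp_apply, hru, ← hl] at hA3
      rw [← hl0, Equiv.swap_apply_right] at hA3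
      rw [e]
      linear_combination hA3
    · have hv : (l : ℕ) = k + 1 := by rw [hl, coe_finRotate_of_ne_last hlast]
      have e : x l - x (k+1) = 0 := by rw [hv]; simp
      have := Acoef_swap Δ p σ k l hv.symm
      rw [e, zpow_zero, zpow_zero]
      linear_combination this
  refine Finset.sum_involution (fun σ _ => σ * Equiv.swap k l) ?_ ?_ (fun _ _ => Finset.mem_univ _) ?_
  · intro σ _
    rw [hrZ, hrZ, hR (σ * Equiv.swap k l : Equiv.Perm _) σ (by
      intro j h1 h2; simp [Equiv.swap_apply_of_ne_of_ne h1 h2])]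
    simp only [Equiv.Perm.coe_mul, Function.comp_apply, Equiv.swap_apply_left, Equiv.swap_apply_right]
    rw [ML_eq c Δ hΔ p _ _ (hz1 _) (hz1 _), ML_eq c Δ hΔ p _ _ (hz1 _) (hz1 _)]
    have e : ∀ j, zOf p j ^ x l = zOf p j ^ (x l - x (k+1)) * zOf p j ^ x (k+1) := by
      intro j; rw [← zpow_add₀ (zOf_ne_zero p j)]; simp
    rw [e, e, mul_comm (1 - zOf p (σ l))]
    linear_combination (-(c:ℂ)^2 / ((1 - zOf p (σ k)) * (1 - zOf p (σ l)))) * R σ *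
      zOf p (σ k) ^ x (k+1) * zOf p (σ l) ^ x (k+1) * hpair σ
  · intro σ _ _ h
    have : Equiv.swap k l = 1 := by simpa using h
    rw [Equiv.swap_eq_one_iff] at this
    exact hkl this
  · intro σ _
    simp [mul_assoc]

open Fin.NatCast in
theorem exists_ML {m : ℕ} (w : Fin (m+1) → Bool) (h1 : w ≠ fun _ => true) (h2 : w ≠ fun _ => false) :
    ∃ k, w k = false ∧ w (finRotate (m+1) k) = true := by
  by_contra! h
  have hs : ∀ k, w k = false → w (k + 1) = false := by
    intro k hk
    have := h k hk
    rw [finRotate_apply] at this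
    simpa using this
  obtain ⟨k, hk⟩ : ∃ k, w k = false := by
    by_contra! hh
    exact h1 (funext fun k => by simpa using hh k)
  have ha : ∀ j : ℕ, w (k + (j : Fin (m+1))) = false := by
    intro j
    induction j with
    | zero => simpa using hk
    | succ j ih => have := hs _ ih; push_cast; rwa [← add_assoc]
  apply h2
  funext j
  have := ha (j - k : Fin (m+1))
  simpa using this

def posZ {N : ℕ} (n : ℕ) (B : Finset (Fin N)) (k : Fin n) : ℤ := ((posList B).getD k 0 : ℕ)

theorem posList_eq {N : ℕ} (B : Finset (Fin N)) :
    posList B = (B.sort (· ≤ ·)).map (fun i : Fin N => (i : ℕ) + 1) := by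
  unfold posList
  generalize B.sort (· ≤ ·) = l
  induction l with
  | nil => simp
  | cons a t ih => simpa using ih

theorem posList_length {N : ℕ} (B : Finset (Fin N)) : (posList B).length = B.card := by
  simp [posList]

theorem posZ_eq {N n : ℕ} (B : Finset (Fin N)) (h : B.card = n) (k : Fin n) :
    posZ n B k = ((B.orderEmbOfFin h k : Fin N) : ℕ) + 1 := by
  unfold posZ
  rw [List.getD_eq_getElem _ _ (by rw [posList_length, h]; exact k.2)]
  simp only [posList_eq, Finset.orderEmbOfFin_apply, List.getElem_map]
  push_cast
  rfl

theorem posZ_strictMono {N n : ℕ} (B : Finset (Fin N)) (h : B.card = n) :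
    StrictMono (posZ n B) := by
  intro i j hij
  rw [posZ_eq B h, posZ_eq B h]
  have := (B.orderEmbOfFin h).strictMono hij
  rw [Fin.lt_def] at this
  omega

theorem posZ_bd {N n : ℕ} (B : Finset (Fin N)) (h : B.card = n) (k : Fin n) :
    1 ≤ posZ n B k ∧ posZ n B k ≤ N := by
  rw [posZ_eq B h]
  have := (B.orderEmbOfFin h k).2
  omega

theorem mem_iff_posZ {N n : ℕ} (B : Finset (Fin N)) (h : B.card = n) (i : Fin N) :
    i ∈ B ↔ ∃ k, posZ n B k = (i : ℕ) + 1 := by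
  rw [← Finset.mem_coe, ← Finset.range_orderEmbOfFin B h, Set.mem_range]
  refine exists_congr fun k => ?_
  rw [posZ_eq B h, Fin.ext_iff]
  omega

theorem posZ_inj {N n : ℕ} (B B' : Finset (Fin N)) (h : B.card = n) (h' : B'.card = n)
    (he : posZ n B = posZ n B') : B = B' := by
  ext i
  rw [mem_iff_posZ B h, mem_iff_posZ B' h', he]

theorem posZ_of {N n : ℕ} (B : Finset (Fin N)) (q : Fin n → ℤ) (hq : StrictMono q)
    (hb : ∀ k, 1 ≤ q k ∧ q k ≤ N) (hB : ∀ i : Fin N, i ∈ B ↔ ∃ k, q k = (i : ℕ) + 1) :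
    B.card = n ∧ posZ n B = q := by
  let f : Fin n → Fin N := fun k => ⟨(q k - 1).toNat, by have := hb k; omega⟩
  have hf : StrictMono f := by
    intro i j hij
    have := hq hij
    have := hb i
    have := hb j
    simp only [f, Fin.lt_def]; omega
  have hBf : B = Finset.univ.map ⟨f, hf.injective⟩ := by
    ext i
    rw [hB]
    simp only [Finset.mem_map, Finset.mem_univ, true_and, Function.Embedding.coeFn_mk]
    refine exists_congr fun k => ?_
    have := hb k
    simp only [f, Fin.ext_iff]; omega
  have hc : B.card = n := by rw [hBf]; simp
  refine ⟨hc, ?_⟩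
  have := Finset.orderEmbOfFin_unique hc (f := f) (by intro k; rw [hBf]; simp) hf
  funext k
  rw [posZ_eq B hc, ← this]
  have := hb k
  simp only [f]; omega

theorem exists_posZ {N n : ℕ} (q : Fin n → ℤ) (hq : StrictMono q)
    (hb : ∀ k, 1 ≤ q k ∧ q k ≤ N) : ∃ B : Finset (Fin N), B.card = n ∧ posZ n B = q := by
  classical
  exact ⟨Finset.univ.filter (fun i : Fin N => ∃ k, q k = (i : ℕ) + 1),
    posZ_of _ q hq hb (by intro i; simp)⟩

theorem psiVec_eq {N n : ℕ} (Δ : ℝ) (p : Fin n → ℝ) (B : Finset (Fin N)) (h : B.card = n) :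
    psiVec N n Δ p B = psiT Δ p (posZ n B) := by
  rw [psiVec, dif_pos h, psiT]
  refine Finset.sum_congr rfl fun σ _ => ?_
  congr 1
  refine Finset.prod_congr rfl fun k _ => ?_
  rw [posZ_eq B h, zOf, Finset.coe_orderIsoOfFin_apply]
  generalize ((B.orderEmbOfFin h k : Fin N) : ℕ) = t
  rw [show ((t : ℤ) + 1) = ((t + 1 : ℕ) : ℤ) by push_cast; rfl, zpow_natCast, ← Complex.exp_nat_mul]
  congr 1
  ring

theorem seqInterlace_iff {N n : ℕ} (A B : Finset (Fin N)) (hA : A.card = n) :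
    seqInterlace (posList A) (posList B) ↔ ∀ k : Fin n, posZ n A k ≤ posZ n B k ∧
      ∀ l : Fin n, (l : ℕ) = k + 1 → posZ n B k ≤ posZ n A l := by
  unfold seqInterlace posZ
  rw [posList_length, hA]
  constructor
  · intro h k
    obtain ⟨h1, h2⟩ := h k k.2
    refine ⟨by exact_mod_cast h1, fun l hl => ?_⟩
    have := h2 (by rw [← hl]; exact l.2)
    rw [hl]; exact_mod_cast this
  · intro h i hi
    obtain ⟨h1, h2⟩ := h ⟨i, hi⟩
    refine ⟨by exact_mod_cast h1, fun hl => ?_⟩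
    exact_mod_cast h2 ⟨i+1, hl⟩ rfl

open scoped Classical in
theorem weight_eq {N n : ℕ} (c : ℝ) (A B : Finset (Fin N)) (hA : A.card = n) (hB : B.card = n) :
    (c:ℂ) ^ Pdiff A B = ∏ k : Fin n, if ∃ j, posZ n B k = posZ n A j then (1:ℂ) else (c:ℂ)^2 := by
  have h1 : ∏ k : Fin n, (if ∃ j, posZ n B k = posZ n A j then (1:ℂ) else (c:ℂ)^2) =
      ∏ k : Fin n, (if B.orderEmbOfFin hB k ∈ A then (1:ℂ) else (c:ℂ)^2) := by
    refine Finset.prod_congr rfl fun k _ => ?_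
    congr 1
    rw [mem_iff_posZ A hA, posZ_eq B hB]
    simp only [eq_comm]
  have h2 : ∏ k : Fin n, (if B.orderEmbOfFin hB k ∈ A then (1:ℂ) else (c:ℂ)^2) =
      ∏ b ∈ B, (if b ∈ A then (1:ℂ) else (c:ℂ)^2) := by
    conv_rhs => rw [← Finset.map_orderEmbOfFin_univ B hB]
    rw [Finset.prod_map]; rfl
  rw [h1, h2, Finset.prod_ite, Finset.prod_const_one, one_mul, Finset.prod_const, ← pow_mul]
  congr 1
  have h3 : B.filter (fun b => b ∉ A) = B \ A := by ext; simp
  rw [h3, Pdiff, symmDiff_def, Finset.sup_eq_union, Finset.card_union_of_disjoint disjoint_sdiff_sdiff]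
  have := Finset.card_sdiff_add_card_inter A B
  have := Finset.card_sdiff_add_card_inter B A
  rw [Finset.inter_comm B A] at this
  omega

open scoped Classical in
theorem transferV_eq {N n : ℕ} (c : ℝ) (A B : Finset (Fin N)) (hA : A.card = n) (hB : B.card = n) :
    transferV N c A B = (if seqInterlace (posList B) (posList A) then (c:ℂ) ^ Pdiff A B else 0) +
      (if seqInterlace (posList A) (posList B) then (c:ℂ) ^ Pdiff A B else 0) := by
  unfold transferV Interlaced
  simp only [Matrix.of_apply, hA, hB, true_and]
  have hself : seqInterlace (posList A) (posList A) := by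
    rw [seqInterlace_iff A A hA]
    intro k
    refine ⟨le_rfl, fun l hl => ?_⟩
    exact ((posZ_strictMono A hA) (by rw [Fin.lt_def]; omega)).le
  by_cases h : A = B
  · subst h
    simp [hself, Pdiff]
    norm_num
  · rw [if_neg h]
    by_cases h1 : seqInterlace (posList B) (posList A) <;>
    by_cases h2 : seqInterlace (posList A) (posList B)
    · exfalso; apply h
      refine posZ_inj A B hA hB (funext fun k => ?_)
      rw [seqInterlace_iff _ _ hB] at h1
      rw [seqInterlace_iff _ _ hA] at h2
      exact le_antisymm (h2 k).1 (h1 k).1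
    all_goals simp [h1, h2]

theorem G_eq {m N : ℕ} (x : ℕ → ℤ) (hx0 : x 0 = x (m+1) - N) (y : Fin (m+1) → ℤ)
    (hy : ∀ k : Fin (m+1), x k ≤ y k ∧ y k ≤ x (k+1)) (hC : Decidable (StrictMono y ∧ y (Fin.last m) < y 0 + N)) :
    (∏ k : Fin (m+1), (1 - (if y k = x (k+1) then (1:ℂ) else 0) *
        (if y (finRotate (m+1) k) = x (finRotate (m+1) k : Fin (m+1)) then (1:ℂ) else 0))) =
      if StrictMono y ∧ y (Fin.last m) < y 0 + N then 1 else 0 := by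
  have hc : ∀ k : Fin m, finRotate (m+1) k.castSucc = k.succ := by
    intro k; rw [finRotate_apply]; simp
  rw [Fin.prod_univ_castSucc]
  simp only [hc, finRotate_last]
  have h0 := hy 0
  have hl := hy (Fin.last m)
  simp only [Fin.val_zero, zero_add, Fin.val_last] at h0 hl
  by_cases h : StrictMono y ∧ y (Fin.last m) < y 0 + N
  · rw [if_pos h]
    have e1 : ∀ i : Fin m, (1 - (if y i.castSucc = x (i.castSucc+1) then (1:ℂ) else 0) *
        (if y i.succ = x (i.succ : Fin (m+1)) then (1:ℂ) else 0)) = 1 := by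
      intro i
      have := h.1 (Fin.castSucc_lt_succ (i := i))
      split_ifs with h1 h2 <;> simp
      rw [h1, h2] at this
      simp at this
    rw [Finset.prod_eq_one (fun i _ => e1 i)]
    split_ifs with h1 h2 <;> simp
    simp only [Fin.val_zero, Fin.val_last] at h1 h2
    have := h.2
    omega
  · rw [if_neg h]
    by_cases hm : StrictMono y
    · have h2 : ¬ (y (Fin.last m) < y 0 + N) := fun h2 => h ⟨hm, h2⟩
      rw [if_pos (by simp only [Fin.val_last]; omega), if_pos (by simp only [Fin.val_zero]; omega)]
      simp
    · rw [Fin.strictMono_iff_lt_succ] at hm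
      push Not at hm
      obtain ⟨i, hi⟩ := hm
      have ha := hy i.castSucc
      have hb := hy i.succ
      simp only [Fin.val_castSucc, Fin.val_succ] at ha hb
      rw [Finset.prod_eq_zero (Finset.mem_univ i), zero_mul]
      simp only [Fin.val_castSucc, Fin.val_succ]
      rw [if_pos (by omega), if_pos (by omega)]; simp

theorem end_iff {n : ℕ} (x : ℕ → ℤ) (hxmono : ∀ i j, i < j → j ≤ n → x i < x j)
    (k : ℕ) (hk : 1 ≤ k) (hkn : k + 1 ≤ n) (v : ℤ) (h1 : x k ≤ v) (h2 : v ≤ x (k+1)) :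
    (v = x k ∨ v = x (k+1)) ↔ ∃ j : Fin n, v = x (j+1) := by
  constructor
  · rintro (h | h)
    · exact ⟨⟨k-1, by omega⟩, by rw [h]; congr 1; simp; omega⟩
    · exact ⟨⟨k, by omega⟩, h⟩
  · rintro ⟨j, hj⟩
    have h3 : ¬ ((j:ℕ)+1 < k) := fun h => by have := hxmono _ _ h (by omega); omega
    have h4 : ¬ (k + 1 < (j:ℕ)+1) := fun h => by have := hxmono _ _ h (by omega); omega
    have : (j:ℕ)+1 = k ∨ (j:ℕ)+1 = k+1 := by omega
    rcases this with h | h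
    · left; rw [hj, h]
    · right; rw [hj, h]

theorem box1 {m : ℕ} (x : ℕ → ℤ) (q : Fin (m+1) → ℤ) (h0 : x 0 ≤ q 0) :
    (∀ k : Fin (m+1), q k ≤ x (k+1) ∧ ∀ l : Fin (m+1), (l : ℕ) = k + 1 → x (k+1) ≤ q l) ↔
    q ∈ Fintype.piFinset (fun k : Fin (m+1) => Finset.Icc (x k) (x (k+1))) := by
  simp only [Fintype.mem_piFinset, Finset.mem_Icc]
  constructor
  · intro h k
    refine ⟨?_, (h k).1⟩
    induction k using Fin.cases with
    | zero => exact h0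
    | succ i => 
      have := (h i.castSucc).2 i.succ (by simp)
      simpa using this
  · intro h k
    refine ⟨(h k).2, fun l hl => ?_⟩
    have := (h l).1
    rwa [hl] at this

def unrot {m : ℕ} (N : ℕ) (q : Fin (m+1) → ℤ) : Fin (m+1) → ℤ :=
  Fin.cons (q (Fin.last m) - N) (fun i : Fin m => q i.castSucc)

theorem unrot_zero {m : ℕ} (N : ℕ) (q : Fin (m+1) → ℤ) : unrot N q 0 = q (Fin.last m) - N := by
  simp [unrot]

theorem unrot_succ {m : ℕ} (N : ℕ) (q : Fin (m+1) → ℤ) (i : Fin m) :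
    unrot N q i.succ = q i.castSucc := by
  simp [unrot]

theorem box2 {m N : ℕ} (x : ℕ → ℤ) (hx0 : x 0 = x (m+1) - N) (q : Fin (m+1) → ℤ)
    (h0 : q (Fin.last m) - N ≤ x 1) :
    (∀ k : Fin (m+1), x (k+1) ≤ q k ∧ ∀ l : Fin (m+1), (l : ℕ) = k + 1 → q k ≤ x (l+1)) ↔
    unrot N q ∈ Fintype.piFinset (fun k : Fin (m+1) => Finset.Icc (x k) (x (k+1))) := by
  simp only [Fintype.mem_piFinset, Finset.mem_Icc]
  constructor
  · intro h k
    induction k using Fin.cases with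
    | zero =>
      rw [unrot_zero]
      have := (h (Fin.last m)).1
      simp only [Fin.val_zero, zero_add, Fin.val_last] at this ⊢
      omega
    | succ i => 
      rw [unrot_succ]
      have h1 := (h i.castSucc).2 i.succ (by simp)
      have h2 := (h i.castSucc).1
      simp only [Fin.val_castSucc, Fin.val_succ] at h1 h2 ⊢
      exact ⟨h2, h1⟩
  · intro h k
    induction k using Fin.lastCases with
    | last =>
      have := (h 0).1
      rw [unrot_zero] at this
      simp only [Fin.val_zero, Fin.val_last] at this ⊢
      refine ⟨by omega, fun l hl => ?_⟩
      have := l.2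
      omega
    | cast i =>
      have := h i.succ
      rw [unrot_succ] at this
      simp only [Fin.val_castSucc, Fin.val_succ] at this ⊢
      refine ⟨this.1, fun l hl => ?_⟩
      rw [hl]; exact this.2

theorem main_sum {m N : ℕ} (hN : 1 ≤ N) (c : ℝ) {Δ : ℝ} (p : Fin (m+1) → ℝ)
    (hA : ∀ σ, Acoef Δ p (σ * finRotate (m+1)) * zOf p (σ 0) ^ N = Acoef Δ p σ)
    (x : ℕ → ℤ) (hx0 : x 0 = x (m+1) - N)
    (hxmono : ∀ i j, i < j → j ≤ m+1 → x i < x j)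
    (hx1 : 1 ≤ x 1) (hxN : x (m+1) ≤ (N : ℤ)) :
    (transferV N c).mulVec (psiVec N (m+1) Δ p) (finsetOfX N (m+1) x) =
    ∑ y ∈ Fintype.piFinset (fun k : Fin (m+1) => Finset.Icc (x k) (x (k+1))),
      (∏ k, (if y k = x k ∨ y k = x (k+1) then (1:ℂ) else (c:ℂ)^2)) * psiT Δ p y *
      (∏ k : Fin (m+1), (1 - (if y k = x (k+1) then (1:ℂ) else 0) *
        (if y (finRotate (m+1) k) = x (finRotate (m+1) k : Fin (m+1)) then (1:ℂ) else 0))) := by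
  classical
  set X := finsetOfX N (m+1) x with hX
  set Pi := Fintype.piFinset (fun k : Fin (m+1) => Finset.Icc (x k) (x (k+1))) with hPi
  have memPi : ∀ y, y ∈ Pi ↔ ∀ k : Fin (m+1), x k ≤ y k ∧ y k ≤ x (k+1) := by
    intro y; simp only [hPi, Fintype.mem_piFinset, Finset.mem_Icc]
  have hxle : ∀ i j, i ≤ j → j ≤ m+1 → x i ≤ x j := by
    intro i j hij hj
    rcases hij.lt_or_eq with h | h
    · exact (hxmono i j h hj).le
    · rw [h]
  have hxpos : ∀ i, 1 ≤ i → i ≤ m+1 → 1 ≤ x i := fun i h1 h2 => hx1.trans (hxle 1 i h1 h2)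
  have hxleN : ∀ i, i ≤ m+1 → x i ≤ N := fun i h2 => (hxle i (m+1) h2 le_rfl).trans hxN
  have hx00 : x 0 ≤ 0 := by omega
  obtain ⟨hXc, hXp⟩ : X.card = m+1 ∧ posZ (m+1) X = fun k : Fin (m+1) => x (k+1) := by
    refine posZ_of X _ ?_ ?_ ?_
    · intro i j hij
      exact hxmono _ _ (by rw [Fin.lt_def] at hij; omega) (by omega)
    · intro k
      exact ⟨hxpos _ (by omega) (by omega), hxleN _ (by omega)⟩
    · intro i
      rw [hX, finsetOfX]
      simp only [Finset.mem_filter, Finset.mem_univ, true_and]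
      constructor
      · rintro ⟨k, h1, h2, h3⟩
        exact ⟨⟨k-1, by omega⟩, by rw [← h3]; congr 1; simp; omega⟩
      · rintro ⟨k, h⟩
        exact ⟨k+1, by omega, by omega, h⟩
  -- left-hand side
  have hT1 : ∀ B : Finset (Fin N), B.card = m+1 →
      (seqInterlace (posList B) (posList X) ↔ posZ (m+1) B ∈ Pi) := by
    intro B hB
    rw [seqInterlace_iff _ _ hB, hXp, hPi, ← box1]
    have := (posZ_bd B hB 0).1
    omega
  have hT2 : ∀ B : Finset (Fin N), B.card = m+1 →
      (seqInterlace (posList X) (posList B) ↔ unrot N (posZ (m+1) B) ∈ Pi) := by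
    intro B hB
    rw [seqInterlace_iff _ _ hXc, hXp, hPi, ← box2 x hx0]
    have := (posZ_bd B hB (Fin.last m)).2
    omega
  have hW : ∀ B : Finset (Fin N), B.card = m+1 → (c:ℂ) ^ Pdiff X B =
      ∏ k : Fin (m+1), if ∃ j : Fin (m+1), posZ (m+1) B k = x (j+1) then (1:ℂ) else (c:ℂ)^2 := by
    intro B hB
    rw [weight_eq c X B hXc hB, hXp]
  set W : (Fin (m+1) → ℤ) → ℂ := fun y =>
    ∏ k : Fin (m+1), (if y k = x k ∨ y k = x (k+1) then (1:ℂ) else (c:ℂ)^2) with hWdef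
  set C : (Fin (m+1) → ℤ) → Prop := fun y => StrictMono y ∧ y (Fin.last m) < y 0 + N with hC
  have hL : (transferV N c).mulVec (psiVec N (m+1) Δ p) X =
      ∑ B ∈ Finset.univ.filter (fun B : Finset (Fin N) => B.card = m+1 ∧ posZ (m+1) B ∈ Pi),
        (c:ℂ) ^ Pdiff X B * psiT Δ p (posZ (m+1) B) +
      ∑ B ∈ Finset.univ.filter (fun B : Finset (Fin N) => B.card = m+1 ∧ unrot N (posZ (m+1) B) ∈ Pi),
        (c:ℂ) ^ Pdiff X B * psiT Δ p (posZ (m+1) B) := by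
    rw [Finset.sum_filter, Finset.sum_filter, ← Finset.sum_add_distrib]
    unfold Matrix.mulVec dotProduct
    refine Finset.sum_congr rfl fun B _ => ?_
    change transferV N c X B * psiVec N (m+1) Δ p B = _
    by_cases hB : B.card = m+1
    · rw [transferV_eq c X B hXc hB, psiVec_eq Δ p B hB]
      simp only [hT1 B hB, hT2 B hB, hB, true_and]
      rw [add_mul, ite_mul, ite_mul, zero_mul]
    · rw [psiVec, dif_neg hB]
      simp [hB]
  have hR : ∑ y ∈ Pi, W y * psiT Δ p y *
      (∏ k : Fin (m+1), (1 - (if y k = x (k+1) then (1:ℂ) else 0) *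
        (if y (finRotate (m+1) k) = x (finRotate (m+1) k : Fin (m+1)) then (1:ℂ) else 0))) =
      ∑ y ∈ (Pi.filter C).filter (fun y => 1 ≤ y 0), W y * psiT Δ p y +
      ∑ y ∈ (Pi.filter C).filter (fun y => ¬ 1 ≤ y 0), W y * psiT Δ p y := by
    rw [Finset.sum_filter_add_sum_filter_not, Finset.sum_filter]
    refine Finset.sum_congr rfl fun y hy => ?_
    rw [G_eq x hx0 y ((memPi y).1 hy) inferInstance, mul_ite, mul_one, mul_zero]
  rw [hL, hR]
  congr 1
  · refine Finset.sum_bij (fun B _ => posZ (m+1) B) ?_ ?_ ?_ ?_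
    · intro B hB
      simp only [Finset.mem_filter, Finset.mem_univ, true_and] at hB ⊢
      have h1 := (posZ_bd B hB.1 0).1
      have h2 := (posZ_bd B hB.1 (Fin.last m)).2
      exact ⟨⟨hB.2, posZ_strictMono B hB.1, by omega⟩, h1⟩
    · intro B hB B' hB' he
      simp only [Finset.mem_filter, Finset.mem_univ, true_and] at hB hB'
      exact posZ_inj B B' hB.1 hB'.1 he
    · intro y hy
      simp only [Finset.mem_filter] at hy
      obtain ⟨⟨hyP, hyC⟩, hy0⟩ := hy
      obtain ⟨B, hB, hBy⟩ := exists_posZ (N := N) y hyC.1 (by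
        intro k
        exact ⟨hy0.trans (hyC.1.monotone (Fin.zero_le k)),
          ((memPi y).1 hyP k).2.trans (hxleN _ (by omega))⟩)
      exact ⟨B, by simp [hB, hBy, hyP], hBy⟩
    · intro B hB
      simp only [Finset.mem_filter, Finset.mem_univ, true_and] at hB
      rw [hW B hB.1]
      congr 1
      refine Finset.prod_congr rfl fun k _ => ?_
      have hk := (memPi _).1 hB.2 k
      congr 1
      rw [eq_iff_iff]
      rcases Nat.eq_zero_or_pos (k:ℕ) with h | h
      · have h0 := (posZ_bd B hB.1 k).1
        rw [h] at hk ⊢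
        simp only [zero_add] at hk ⊢
        constructor
        · rintro ⟨j, hj⟩
          right
          have := hxle 1 (j+1) (by omega) (by omega)
          omega
        · rintro (h1 | h1)
          · omega
          · exact ⟨0, h1⟩
      · exact (end_iff x hxmono k h (by omega) _ hk.1 hk.2).symm
  · have hinv : ∀ q : Fin (m+1) → ℤ, psiT Δ p q = psiT Δ p (unrot N q) := by
      intro q
      refine psiT_rot p hA (unrot N q) q (fun k => (unrot_succ N q k).symm) ?_
      rw [unrot_zero]; ring
    refine Finset.sum_bij (fun B _ => unrot N (posZ (m+1) B)) ?_ ?_ ?_ ?_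
    · intro B hB
      simp only [Finset.mem_filter, Finset.mem_univ, true_and] at hB ⊢
      have hm := posZ_strictMono B hB.1
      have h2 := (posZ_bd B hB.1 (Fin.last m)).2
      refine ⟨⟨hB.2, ?_, ?_⟩, ?_⟩
      · intro i j hij
        induction j using Fin.cases with
        | zero => simp at hij
        | succ j =>
          rw [unrot_succ]
          induction i using Fin.cases with
          | zero => 
            rw [unrot_zero]
            have := (posZ_bd B hB.1 j.castSucc).1
            omega
          | succ i =>
            rw [unrot_succ]
            exact hm (by simpa using hij)
      · rw [unrot_zero]
        have : ∀ j, unrot N (posZ (m+1) B) j < posZ (m+1) B (Fin.last m) := by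
          intro j
          induction j using Fin.cases with
          | zero => rw [unrot_zero]; omega
          | succ j => rw [unrot_succ]; exact hm (Fin.castSucc_lt_last j)
        have := this (Fin.last m)
        omega
      · rw [unrot_zero]; omega
    · intro B hB B' hB' he
      simp only [Finset.mem_filter, Finset.mem_univ, true_and] at hB hB'
      refine posZ_inj B B' hB.1 hB'.1 (funext fun k => ?_)
      induction k using Fin.lastCases with
      | last => have := congrFun he 0; simp only [unrot_zero] at this; omega
      | cast i => have := congrFun he i.succ; simpa only [unrot_succ] using this
    · intro y hy
      simp only [Finset.mem_filter] at hy
      obtain ⟨⟨hyP, hyC⟩, hy0⟩ := hy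
      have hyb := (memPi y).1 hyP
      let q : Fin (m+1) → ℤ := Fin.snoc (fun i : Fin m => y i.succ) (y 0 + N)
      have hql : q (Fin.last m) = y 0 + N := by simp [q]
      have hqc : ∀ i : Fin m, q i.castSucc = y i.succ := by intro i; simp [q]
      have hu : unrot N q = y := by
        funext k
        induction k using Fin.cases with
        | zero => rw [unrot_zero, hql]; ring
        | succ i => rw [unrot_succ, hqc]
      obtain ⟨B, hB, hBy⟩ := exists_posZ (N := N) q (by
        intro i j hij
        induction i using Fin.lastCases with
        | last => exact absurd hij (not_lt.mpr (Fin.le_last j))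
        | cast i => 
          rw [hqc]
          induction j using Fin.lastCases with
          | last =>
            rw [hql]
            exact lt_of_le_of_lt (hyC.1.monotone (Fin.le_last _)) hyC.2
          | cast j =>
            rw [hqc]
            exact hyC.1 (by simpa using hij)) (by
        intro k
        induction k using Fin.lastCases with
        | last =>
          rw [hql]
          have := hyb 0
          simp only [Fin.val_zero] at this
          have := hxpos (m+1) (by omega) le_rfl
          omega
        | cast i =>
          rw [hqc]
          have := hyb i.succ
          simp only [Fin.val_succ] at this
          have := hxpos (i+1) (by omega) (by omega)
          have := hxleN (i+1+1) (by omega)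
          omega)
      exact ⟨B, by simp [hB, hBy, hu, hyP], by rw [hBy, hu]⟩
    · intro B hB
      simp only [Finset.mem_filter, Finset.mem_univ, true_and] at hB
      rw [hW B hB.1, hinv]
      congr 1
      have hb := (memPi _).1 hB.2
      simp only [hWdef]
      rw [Fin.prod_univ_castSucc, Fin.prod_univ_succ, mul_comm]
      congr 1
      · have h0 := hb 0
        rw [unrot_zero] at h0 ⊢
        have h2 := (posZ_bd B hB.1 (Fin.last m)).2
        simp only [Fin.val_zero, zero_add] at h0 ⊢
        congr 1
        rw [eq_iff_iff]
        constructor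
        · rintro ⟨j, hj⟩
          left
          have := hxle (j+1) (m+1) (by omega) le_rfl
          omega
        · rintro (h1 | h1)
          · exact ⟨Fin.last m, by simp only [Fin.val_last]; omega⟩
          · omega
      · refine Finset.prod_congr rfl fun i _ => ?_
        have h0 := hb i.succ
        rw [unrot_succ] at h0 ⊢
        simp only [Fin.val_succ] at h0 ⊢
        congr 1
        rw [eq_iff_iff]
        exact (end_iff x hxmono (i+1) (by omega) (by omega) _ h0.1 h0.2).symm

end VpsiAux


/-- **Reduction to the two constant words, and their contributions.** -/
theorem Vpsi_constant_words
    (N n : ℕ) (hn : 1 ≤ n) (hnN : 2 * n ≤ N)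
    (c : ℝ) (hc : 0 < c) (Δ : ℝ) (hΔ : Δ = (2 - c ^ 2) / 2)
    (Θ : ℝ → ℝ → ℝ)
    (hΘcont : ContinuousOn (fun q : ℝ × ℝ => Θ q.1 q.2) (Ddom Δ ×ˢ Ddom Δ))
    (hΘzero : Θ 0 0 = 0)
    (hΘ : ∀ a ∈ Ddom Δ, ∀ b ∈ Ddom Δ,
      Complex.exp (-(Complex.I * (Θ a b : ℂ))) =
        Complex.exp (Complex.I * ((a : ℂ) - (b : ℂ))) * Sfun Δ a b / Sfun Δ b a)
    (p : Fin n → ℝ) (hpD : ∀ j, p j ∈ Ddom Δ)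
    (hdistinct : Function.Injective p)
    (hnonzero : ∀ j, p j ≠ 0)
    (hBE : ∀ j, Complex.exp (Complex.I * (N : ℂ) * (p j : ℂ)) =
      (-1 : ℂ) ^ (n - 1) *
        Complex.exp (-(Complex.I * ((∑ k, Θ (p j) (p k) : ℝ) : ℂ))))
    (x : ℕ → ℤ) (hx0 : x 0 = x n - N)
    (hxmono : ∀ i j, i < j → j ≤ n → x i < x j)
    (hx1 : 1 ≤ x 1) (hxN : x n ≤ (N : ℤ))
    :
    ((transferV N c).mulVec (psiVec N n Δ p) (finsetOfX N n x) =
        (∑ σ : Equiv.Perm (Fin n), Acoef Δ p σ *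
            (rword c (zOf p) σ (fun _ => true) * Zword x (zOf p) σ (fun _ => true))) +
          ∑ σ : Equiv.Perm (Fin n), Acoef Δ p σ *
            (rword c (zOf p) σ (fun _ => false) * Zword x (zOf p) σ (fun _ => false))) ∧
    (∑ σ : Equiv.Perm (Fin n), Acoef Δ p σ *
        (rword c (zOf p) σ (fun _ => false) * Zword x (zOf p) σ (fun _ => false)) =
      (∏ i, Mfun c (zOf p i)) *
        ∑ σ : Equiv.Perm (Fin n), Acoef Δ p σ *
          ∏ k : Fin n, zOf p (σ k) ^ (x ((k : ℕ) + 1))) ∧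
    (∑ σ : Equiv.Perm (Fin n), Acoef Δ p σ *
        (rword c (zOf p) σ (fun _ => true) * Zword x (zOf p) σ (fun _ => true)) =
      (∏ i, Lfun c (zOf p i)) *
        ∑ σ : Equiv.Perm (Fin n), Acoef Δ p σ *
          ∏ k : Fin n, zOf p (σ k) ^ (x ((k : ℕ) + 1))) := by
  obtain ⟨m, rfl⟩ : ∃ m, n = m + 1 := ⟨n - 1, by omega⟩
  have hA := VpsiAux.Acoef_rot hΘ p hpD hBE
  have hr := VpsiAux.z_not_real p hpD hnonzero
  have hz1 : ∀ j, zOf p j ≠ 1 := fun j => by simpa using hr j 1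
  have hz0 : ∀ j, zOf p j ≠ 0 := fun j => by simpa using hr j 0
  have hx : ∀ k : Fin (m+1), x k < x (k+1) := fun k => hxmono _ _ (by omega) (by omega)
  have hM : ∀ j, Mfun c (zOf p j) ≠ 0 := fun j => VpsiAux.M_ne c p j (hr j)
  have hL : ∀ j, Lfun c (zOf p j) ≠ 0 := fun j => VpsiAux.L_ne c p j (hr j)
  refine ⟨?_, ?_, ?_⟩
  · rw [VpsiAux.main_sum (by omega) c p hA x hx0 hxmono hx1 hxN]
    have key : ∀ (W : (Fin (m+1) → ℤ) → Fin (m+1) → ℂ) (G : (Fin (m+1) → ℤ) → ℂ)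
        (P : Finset (Fin (m+1) → ℤ)),
        ∑ y ∈ P, (∏ k, W y k) * VpsiAux.psiT Δ p y * G y =
        ∑ σ : Equiv.Perm (Fin (m+1)), Acoef Δ p σ *
          ∑ y ∈ P, (∏ k, W y k * zOf p (σ k) ^ (y k)) * G y := by
      intro W G P
      simp only [VpsiAux.psiT, Finset.mul_sum, Finset.sum_mul, Finset.prod_mul_distrib]
      rw [Finset.sum_comm]
      refine Finset.sum_congr rfl fun σ _ => Finset.sum_congr rfl fun y _ => ?_
      ring
    rw [key (fun y k => if y k = x k ∨ y k = x (k+1) then (1:ℂ) else (c:ℂ)^2)]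
    have hw := VpsiAux.word_sum c (zOf p) hM hL hz1 hz0 x hx
    simp only [hw, Finset.mul_sum]
    rw [Finset.sum_comm]
    refine Finset.sum_eq_add (fun _ => true) (fun _ => false) ?_ ?_ ?_ ?_
    · intro h
      have := congrFun h 0
      simp at this
    · intro w _ h
      obtain ⟨k, hk, hk'⟩ := VpsiAux.exists_ML w h.1 h.2
      exact VpsiAux.vanish c hΔ p hA hz1 x hx0 w k hk hk'
    · intro h; exact absurd (Finset.mem_univ _) h
    · intro h; exact absurd (Finset.mem_univ _) h
  · rw [Finset.mul_sum]
    refine Finset.sum_congr rfl fun σ _ => ?_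
    rw [← Equiv.prod_comp σ]
    simp only [rword, Zword]
    simp
    ring
  · have hpsi := VpsiAux.psiT_rot p hA (fun k : Fin (m+1) => x k) (fun k : Fin (m+1) => x (k+1))
      (by intro k; simp) (by simp; omega)
    simp only [VpsiAux.psiT] at hpsi
    rw [hpsi, Finset.mul_sum]
    refine Finset.sum_congr rfl fun σ _ => ?_
    rw [← Equiv.prod_comp σ]
    simp only [rword, Zword]
    simp
    ring
end
end
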